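/- arXiv:1912.04745 — 2 statements merged into one kernel-verified Lean document; each statement's English description precedes it below -/
import Mathlib

section
/- Assume gcd(s+l,2l) = 2·gcd(s,l), and write d = gcd(s,l). Then the number of quadruples (a,b,c,h) ∈ F_{p^s} × F_q × F_q × F_p for which the codeword c(a,b,c,h) has Hamming weight p^{s−1}(p−1)(p^s + 1) equals p^{m+3d}(p^m − p^{m−2d} − p^{m−3d} + p^s − p^{s−d} + 1)(p^s − 1)/((p^d+1)(p^{2d}−1)). -/
/-- `trp p r z = z + z^p + ⋯ + z^(p^(r-1))`, the trace form used for `Tr_r`. -/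
def trp (p r : ℕ) {F : Type} [Field F] (z : F) : F :=
  ∑ i ∈ Finset.range r, z ^ p ^ i

/-- The codeword `c(a,b,c,h)` of the code `C`, viewed as a function on `F_q = F`;
its value at `x` is `Tr_s(a x^(p^s+1)) + Tr_m(b x^(p^l+1) + c x) + h` (the values
lie in the prime field `F_p ⊆ F`). Here `m = 2s`. -/
def cword (p s l : ℕ) {F : Type} [Field F] (a b c : F) (h : ZMod p) : F → F :=
  fun x => trp p s (a * x ^ (p ^ s + 1)) + trp p (2 * s) (b * x ^ (p ^ l + 1) + c * x)
    + ZMod.cast h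

/-- The support of the codeword `c(a,b,c,h)`; its cardinality is the Hamming weight. -/
def suppw (p s l : ℕ) {F : Type} [Field F] [Fintype F] [DecidableEq F]
    (a b c : F) (h : ZMod p) : Finset F :=
  Finset.univ.filter fun x => cword p s l a b c h x ≠ 0

section FrobeniusPowers

theorem pow_pow_mul_add_of_fixed {M : Type*} [Monoid M] {x : M} {p n : ℕ}
    (h : x ^ p ^ n = x) (k r : ℕ) : x ^ p ^ (n * k + r) = x ^ p ^ r := by
  have hk : x ^ p ^ (n * k) = x := by
    induction k with
    | zero => simp
    | succ k ih => rw [Nat.mul_succ, pow_add, pow_mul, ih, h]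
  rw [pow_add, pow_mul, hk]

theorem pow_pow_gcd_of_fixed {M : Type*} [Monoid M] {x : M} {p m n : ℕ}
    (hm : x ^ p ^ m = x) (hn : x ^ p ^ n = x) : x ^ p ^ m.gcd n = x := by
  have key : ∀ k, (fun y : M => y ^ p)^[k] x = x ^ p ^ k := by
    intro k
    induction k with
    | zero => simp
    | succ k ih => rw [Function.iterate_succ_apply', ih, ← pow_mul, pow_succ]
  have := Function.IsPeriodicPt.gcd (f := fun y : M => y ^ p) (x := x) (m := m) (n := n)
    (by rw [Function.IsPeriodicPt, Function.IsFixedPt, key, hm])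
    (by rw [Function.IsPeriodicPt, Function.IsFixedPt, key, hn])
  rwa [Function.IsPeriodicPt, Function.IsFixedPt, key] at this

variable {F : Type*} [Field F] [Fintype F]

theorem exists_pow_eq_of_pow_eq_one {m n : ℕ} (hcard : Fintype.card F - 1 = m * n)
    {v : F} (hv0 : v ≠ 0) (hv : v ^ n = 1) : ∃ g : F, g ^ m = v := by
  classical
  obtain ⟨γ, hγ⟩ := IsCyclic.exists_generator (α := Fˣ)
  obtain ⟨j, hj⟩ := Subgroup.mem_zpowers_iff.1 (hγ (Units.mk0 v hv0))
  have hord : orderOf γ = m * n := by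
    rw [orderOf_eq_card_of_forall_mem_zpowers hγ, Nat.card_eq_fintype_card, Fintype.card_units,
      hcard]
  have hpos : m * n ≠ 0 := by
    rw [← hcard]; have := Fintype.one_lt_card (α := F); omega
  have hn0 : (n : ℤ) ≠ 0 := by
    rintro h; apply hpos; have : n = 0 := by exact_mod_cast h
    simp [this]
  have h1 : γ ^ (j * n) = 1 := by
    rw [zpow_mul, hj]; ext; simpa using hv
  rw [← orderOf_dvd_iff_zpow_eq_one, hord] at h1
  push_cast at h1
  obtain ⟨k, rfl⟩ := Int.dvd_of_mul_dvd_mul_right hn0 h1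
  refine ⟨((γ ^ k : Fˣ) : F), ?_⟩
  have : (γ ^ k) ^ m = Units.mk0 v hv0 := by
    rw [← hj, ← zpow_natCast, ← zpow_mul, mul_comm]
  simpa using congrArg Units.val this

theorem card_pow_eq_one_of_dvd [DecidableEq F] {m : ℕ} (hm : m ∣ Fintype.card F - 1) :
    (Finset.univ.filter fun x : F => x ^ m = 1).card = m := by
  obtain ⟨n, hn⟩ := hm
  have hpos : m * n ≠ 0 := by
    rw [← hn]; have := Fintype.one_lt_card (α := F); omega
  have hm0 : 0 < m := Nat.pos_of_ne_zero (by rintro rfl; simp at hpos)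
  obtain ⟨γ, hγ⟩ := IsCyclic.exists_generator (α := Fˣ)
  have hord : orderOf γ = m * n := by
    rw [orderOf_eq_card_of_forall_mem_zpowers hγ, Nat.card_eq_fintype_card, Fintype.card_units, hn]
  have h2 : orderOf (γ ^ n) = m := by
    rw [orderOf_pow, hord, Nat.gcd_mul_left_left, Nat.mul_div_cancel]
    exact Nat.pos_of_ne_zero (by rintro rfl; simp at hpos)
  have h3 : IsPrimitiveRoot ((γ ^ n : Fˣ) : F) m := by
    have := IsPrimitiveRoot.orderOf (γ ^ n)
    rw [h2] at this
    exact IsPrimitiveRoot.coe_units_iff.2 this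
  refine Eq.trans (congrArg Finset.card ?_) h3.card_nthRootsFinset
  ext x
  simp [Polynomial.mem_nthRootsFinset hm0]

theorem card_pow_eq_pow_of_dvd [DecidableEq F] {m : ℕ} (hm : m ∣ Fintype.card F - 1) {x : F}
    (hx : x ≠ 0) : (Finset.univ.filter fun y : F => y ^ m = x ^ m).card = m := by
  refine Eq.trans ?_ (card_pow_eq_one_of_dvd hm)
  refine Finset.card_bij' (fun y _ => y / x) (fun w _ => w * x) ?_ ?_ ?_ ?_
  · intro y hy
    simp only [Finset.mem_filter, Finset.mem_univ, true_and] at hy ⊢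
    rw [div_pow, hy, div_self (pow_ne_zero _ hx)]
  · intro w hw
    simp only [Finset.mem_filter, Finset.mem_univ, true_and] at hw ⊢
    rw [mul_pow, hw, one_mul]
  · intro y _; exact div_mul_cancel₀ y hx
  · intro w _; exact mul_div_cancel_right₀ w hx

theorem card_pow_eq_self_le [DecidableEq F] {n : ℕ} (hn : 1 < n) :
    (Finset.univ.filter fun x : F => x ^ n = x).card ≤ n := by
  have hne : (Polynomial.X ^ n - Polynomial.X : Polynomial F) ≠ 0 :=
    FiniteField.X_pow_card_sub_X_ne_zero F hn
  refine le_trans (Finset.card_le_card (t := (Polynomial.X ^ n - Polynomial.X :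
    Polynomial F).roots.toFinset) ?_) ?_
  · intro x hx
    simp only [Finset.mem_filter, Finset.mem_univ, true_and] at hx
    simp [Polynomial.mem_roots hne, hx]
  · refine (Multiset.toFinset_card_le _).trans ((Polynomial.card_roots' _).trans ?_)
    rw [FiniteField.X_pow_card_sub_X_natDegree_eq F hn]

/-- Solutions of a first-order linear equation `A σ(x) + B x = 0`, `A ≠ 0`. -/
theorem card_linear_recurrence_one_le [DecidableEq F] (σ : F →+* F) {A : F} (B : F) (hA : A ≠ 0) :
    (Finset.univ.filter fun x : F => A * σ x + B * x = 0).card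
      ≤ (Finset.univ.filter fun x : F => σ x = x).card := by
  by_cases h : ∃ x₀ : F, x₀ ≠ 0 ∧ A * σ x₀ + B * x₀ = 0
  · obtain ⟨x₀, h0, hx₀⟩ := h
    refine Finset.card_le_card_of_injOn (fun x => x / x₀) ?_ ?_
    · intro x hx
      simp only [Finset.coe_filter, Finset.mem_univ, true_and, Set.mem_ofPred_eq] at hx ⊢
      have hσ : σ x₀ ≠ 0 := (map_ne_zero σ).2 h0
      rw [map_div₀, div_eq_div_iff hσ h0]
      apply mul_left_cancel₀ hA
      linear_combination x₀ * hx - x * hx₀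
    · intro x _ y _ hxy
      exact (div_left_inj' h0).1 hxy
  · push Not at h
    refine Finset.card_le_card_of_injOn id ?_ (Function.injective_id.injOn)
    intro x hx
    simp only [Finset.coe_filter, Finset.mem_univ, true_and, Set.mem_ofPred_eq, id] at hx ⊢
    have : x = 0 := by by_contra h0; exact h x h0 hx
    simp [this]

/-- Solutions of a second-order linear equation `A σ²(x) + B σ(x) + C x = 0`, `A ≠ 0`. -/
theorem card_linear_recurrence_two_le [DecidableEq F] (σ : F →+* F) {A : F} (B C : F)
    (hA : A ≠ 0) :
    (Finset.univ.filter fun x : F => A * σ (σ x) + B * σ x + C * x = 0).card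
      ≤ (Finset.univ.filter fun x : F => σ x = x).card ^ 2 := by
  set e := (Finset.univ.filter fun x : F => σ x = x).card with he
  have he1 : 1 ≤ e := Finset.card_pos.2 ⟨0, by simp⟩
  by_cases h : ∃ x₀ : F, x₀ ≠ 0 ∧ A * σ (σ x₀) + B * σ x₀ + C * x₀ = 0
  · obtain ⟨x₀, h0, hx₀⟩ := h
    have hσ : σ x₀ ≠ 0 := (map_ne_zero σ).2 h0
    have hσσ : σ (σ x₀) ≠ 0 := (map_ne_zero σ).2 hσ
    set D := A * σ (σ x₀) with hD
    have hD0 : D ≠ 0 := mul_ne_zero hA hσσ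
    set W := Finset.univ.filter fun w : F => D * σ w + (D + B * σ x₀) * w = 0 with hW
    have hWc : W.card ≤ e := card_linear_recurrence_one_le σ _ hD0
    have hmaps : ∀ x ∈ Finset.univ.filter (fun x : F => A * σ (σ x) + B * σ x + C * x = 0),
        σ (x / x₀) - x / x₀ ∈ W := by
      intro x hx
      simp only [Finset.mem_filter, Finset.mem_univ, true_and, hW] at hx ⊢
      obtain ⟨z, rfl⟩ : ∃ z, x = x₀ * z := ⟨x / x₀, by field_simp⟩
      have hz : x₀ * z / x₀ = z := by field_simp
      rw [hz]
      simp only [map_mul, map_sub] at hx ⊢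
      rw [hD]
      linear_combination hx - z * hx₀
    refine (Finset.card_le_mul_card_image_of_maps_to hmaps e ?_).trans ?_
    · intro w _
      by_cases hne : (Finset.univ.filter (fun x : F => A * σ (σ x) + B * σ x + C * x = 0)
          |>.filter fun x => σ (x / x₀) - x / x₀ = w).Nonempty
      · obtain ⟨x₁, hx₁⟩ := hne
        refine Finset.card_le_card_of_injOn (fun x => x / x₀ - x₁ / x₀) ?_ ?_
        · intro x hx
          simp only [Finset.coe_filter, Finset.mem_filter, Finset.mem_univ, true_and,
            Set.mem_ofPred_eq] at hx hx₁ ⊢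
          rw [map_sub]
          linear_combination hx.2 - hx₁.2
        · intro x _ y _ hxy
          exact (div_left_inj' h0).1 (sub_left_injective hxy)
      · rw [Finset.not_nonempty_iff_eq_empty] at hne
        rw [hne]; simp
    · rw [sq]; exact Nat.mul_le_mul_left _ hWc
  · push Not at h
    refine le_trans (Finset.card_le_card (t := {0}) ?_) ?_
    · intro x hx
      simp only [Finset.mem_filter, Finset.mem_univ, true_and, Finset.mem_singleton] at hx ⊢
      by_contra h0; exact h x h0 hx
    · simpa using Nat.one_le_pow _ _ he1

end FrobeniusPowers

/-- Numerical conditions: `s` and `l` are odd multiples of `d = gcd(s,l)`, and `F` has `p ^ (2 * s)`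
elements. -/
structure OddMultiples (p s l d : ℕ) (F : Type) [Fintype F] : Prop where
  odd : Odd p
  d_pos : 0 < d
  d_lt : d < s
  s_eq : ∃ i, s = 2 * d * i + d
  l_eq : ∃ j, l = 2 * d * j + d
  l_le : l ≤ 2 * s
  gcd_eq : Nat.gcd (s + l) (2 * s) = 2 * d
  card_eq : Fintype.card F = p ^ (2 * s)

theorem OddMultiples.of_gcd {p s l d : ℕ} {F : Type} [Fintype F] (hodd : Odd p) (hs : 2 ≤ s)
    (hl1 : 1 ≤ l) (hls : l ≠ s) (hl2 : l ≤ 2 * s - 1) (hF : Fintype.card F = p ^ (2 * s))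
    (hd : Nat.gcd s l = d) (hd' : Nat.gcd (s + l) (2 * l) = 2 * d) :
    OddMultiples p s l d F := by
  have hdpos : 0 < d := by rw [← hd]; exact Nat.gcd_pos_of_pos_left _ (by omega)
  obtain ⟨s', hs'⟩ : d ∣ s := hd ▸ Nat.gcd_dvd_left s l
  obtain ⟨l', hl'⟩ : d ∣ l := hd ▸ Nat.gcd_dvd_right s l
  have hcop : Nat.gcd s' l' = 1 := by
    have : d * Nat.gcd s' l' = d * 1 := by rw [← Nat.gcd_mul_left, ← hs', ← hl', hd, mul_one]
    exact Nat.eq_of_mul_eq_mul_left hdpos this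
  obtain ⟨k, hk⟩ : 2 * d ∣ s + l := hd' ▸ Nat.gcd_dvd_left _ _
  have hsum : s' + l' = 2 * k := by
    apply Nat.eq_of_mul_eq_mul_left hdpos
    rw [mul_add, ← hs', ← hl', hk]; ring
  have hs'odd : s' % 2 = 1 := by
    by_contra h
    have h1 : 2 ∣ s' := by omega
    have h2 : 2 ∣ l' := by omega
    have := Nat.dvd_gcd h1 h2
    rw [hcop] at this; omega
  have hl'odd : l' % 2 = 1 := by omega
  refine ⟨hodd, hdpos, ?_, ⟨s' / 2, ?_⟩, ⟨l' / 2, ?_⟩, by omega, ?_, hF⟩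
  · rcases Nat.lt_or_ge 1 s' with h | h
    · rw [hs']; nlinarith
    · exfalso
      have hs1 : s' = 1 := by omega
      have hl3 : l' < 2 := by
        by_contra h2
        have : d * 2 ≤ d * l' := Nat.mul_le_mul_left _ (by omega)
        rw [hs1] at hs'
        omega
      have hl1' : l' = 1 := by omega
      rw [hs1] at hs'; rw [hl1'] at hl'; omega
  · conv_lhs => rw [hs', show s' = 2 * (s' / 2) + 1 by omega]
    ring
  · conv_lhs => rw [hl', show l' = 2 * (l' / 2) + 1 by omega]
    ring
  · rw [← hd']
    apply Nat.dvd_antisymm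
    · refine Nat.dvd_gcd (Nat.gcd_dvd_left _ _) ?_
      have h1 := Nat.gcd_dvd_left (s + l) (2 * s)
      have h2 := Nat.gcd_dvd_right (s + l) (2 * s)
      have := Nat.dvd_sub (h1.mul_left 2) h2
      rwa [show 2 * (s + l) - 2 * s = 2 * l by omega] at this
    · refine Nat.dvd_gcd (Nat.gcd_dvd_left _ _) ?_
      have h1 := Nat.gcd_dvd_left (s + l) (2 * l)
      have h2 := Nat.gcd_dvd_right (s + l) (2 * l)
      have := Nat.dvd_sub (h1.mul_left 2) h2
      rwa [show 2 * (s + l) - 2 * l = 2 * s by omega] at this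

theorem OddMultiples.two_lt {p s l d : ℕ} {F : Type} [Fintype F] (C : OddMultiples p s l d F)
    [Fact p.Prime] : 2 < p :=
  lt_of_le_of_ne (Fact.out : p.Prime).two_le fun h => by
    have := C.odd; rw [← h] at this; exact absurd this (by decide)

namespace OddMultiples

variable {p s l d : ℕ} {F : Type} [Field F] [Fintype F]

theorem pow_card (C : OddMultiples p s l d F) (x : F) : x ^ p ^ (2 * s) = x := by
  rw [← C.card_eq]; exact FiniteField.pow_card x

theorem pow_add_one_of_fixed (C : OddMultiples p s l d F) {x : F} (hx : x ^ p ^ (2 * d) = x) :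
    x ^ (p ^ s + 1) = x ^ (p ^ d + 1) ∧ x ^ (p ^ l + 1) = x ^ (p ^ d + 1) := by
  obtain ⟨i, hi⟩ := C.s_eq
  obtain ⟨j, hj⟩ := C.l_eq
  simp only [pow_succ]
  rw [hi, hj, pow_pow_mul_add_of_fixed hx, pow_pow_mul_add_of_fixed hx]
  exact ⟨rfl, rfl⟩

theorem fixed_of_fixed_add (C : OddMultiples p s l d F) {x : F} (hx : x ^ p ^ (s + l) = x) :
    x ^ p ^ (2 * d) = x := by
  rw [← C.gcd_eq]; exact pow_pow_gcd_of_fixed hx (C.pow_card x)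

theorem mul_dvd_card_sub_one (C : OddMultiples p s l d F) :
    (p ^ d + 1) * (p - 1) ∣ Fintype.card F - 1 := by
  obtain ⟨i, hi⟩ := C.s_eq
  have h1 : p - 1 ∣ p ^ d - 1 := by simpa using Nat.sub_dvd_pow_sub_pow p 1 d
  have h2 : (p ^ d + 1) * (p ^ d - 1) = p ^ (2 * d) - 1 := by
    have := Nat.sq_sub_sq (p ^ d) 1
    rw [mul_comm 2 d, pow_mul, ← this, one_pow]
  have h3 : p ^ (2 * d) - 1 ∣ Fintype.card F - 1 := by
    rw [C.card_eq, show 2 * s = (2 * d) * (2 * i + 1) by rw [hi]; ring, pow_mul p (2 * d)]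
    have := Nat.sub_dvd_pow_sub_pow (p ^ (2 * d)) 1 (2 * i + 1)
    rwa [one_pow] at this
  exact (Nat.mul_dvd_mul_left _ h1).trans (h2 ▸ h3)

theorem dvd_card_sub_one (C : OddMultiples p s l d F) : p ^ d + 1 ∣ Fintype.card F - 1 :=
  (Dvd.intro _ rfl).trans C.mul_dvd_card_sub_one

theorem pow_eq_pow_iff (C : OddMultiples p s l d F) {x y : F} (hx : x ≠ 0) :
    (y ^ (p ^ s + 1) = x ^ (p ^ s + 1) ∧ y ^ (p ^ l + 1) = x ^ (p ^ l + 1)) ↔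
      y ^ (p ^ d + 1) = x ^ (p ^ d + 1) := by
  obtain ⟨w, rfl⟩ : ∃ w, y = w * x := ⟨y / x, (div_mul_cancel₀ y hx).symm⟩
  have key : ∀ n, (w * x) ^ n = x ^ n ↔ w ^ n = 1 := fun n => by
    rw [mul_pow]; exact mul_eq_right₀ (pow_ne_zero _ hx)
  rw [key, key, key]
  constructor
  · rintro ⟨h1, h2⟩
    have hw : w ≠ 0 := by
      rintro rfl
      simp at h1
    have h3 : w ^ p ^ s = w⁻¹ := eq_inv_of_mul_eq_one_left (by rwa [pow_succ] at h1)
    have h4 : w ^ p ^ l = w⁻¹ := eq_inv_of_mul_eq_one_left (by rwa [pow_succ] at h2)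
    have h5 : w ^ p ^ (s + l) = w := by
      rw [pow_add, pow_mul, h3, inv_pow, h4, inv_inv]
    rw [← (C.pow_add_one_of_fixed (C.fixed_of_fixed_add h5)).1, h1]
  · intro h
    have hw : w ≠ 0 := by
      rintro rfl
      simp at h
    have h3 : w ^ p ^ d = w⁻¹ := eq_inv_of_mul_eq_one_left (by rwa [pow_succ] at h)
    have h5 : w ^ p ^ (2 * d) = w := by
      rw [two_mul, pow_add, pow_mul, h3, inv_pow, h3, inv_inv]
    rw [(C.pow_add_one_of_fixed h5).1, (C.pow_add_one_of_fixed h5).2]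
    exact ⟨h, h⟩

theorem exists_similitude (C : OddMultiples p s l d F) [Fact p.Prime] [Algebra (ZMod p) F]
    {v : ZMod p} (hv : v ≠ 0) : ∃ g : F, g ≠ 0 ∧ g ^ (p ^ s + 1) = algebraMap (ZMod p) F v ∧
      g ^ (p ^ l + 1) = algebraMap (ZMod p) F v := by
  set V := algebraMap (ZMod p) F v with hV
  have hV0 : V ≠ 0 := (map_ne_zero _).2 hv
  have hV1 : V ^ (p - 1) = 1 := by rw [hV, ← map_pow, ZMod.pow_card_sub_one_eq_one hv, map_one]
  obtain ⟨e, he⟩ := C.mul_dvd_card_sub_one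
  obtain ⟨g, hg⟩ := exists_pow_eq_of_pow_eq_one (m := (p ^ d + 1) * e) (n := p - 1)
    (by rw [he]; ring) hV0 hV1
  have hg' : (g ^ e) ^ (p ^ d + 1) = V := by rw [← pow_mul, mul_comm, hg]
  have hfix : (g ^ e) ^ p ^ (2 * d) = g ^ e := by
    have hp1 : 1 ≤ p ^ d := Nat.one_le_pow _ _ (Fact.out : p.Prime).pos
    have : p ^ (2 * d) = (p ^ d + 1) * (p ^ d - 1) + 1 := by
      obtain ⟨n, hn⟩ := Nat.exists_eq_add_of_le hp1
      rw [two_mul, pow_add, hn]; simp; ring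
    obtain ⟨k, hk⟩ : p - 1 ∣ p ^ d - 1 := by simpa using Nat.sub_dvd_pow_sub_pow p 1 d
    rw [this, pow_succ, pow_mul, hg', hk, pow_mul, hV1, one_pow, one_mul]
  refine ⟨g ^ e, ?_, ?_, ?_⟩
  · rintro h; rw [h, zero_pow (by omega)] at hg'; exact hV0 hg'.symm
  · rw [(C.pow_add_one_of_fixed hfix).1, hg']
  · rw [(C.pow_add_one_of_fixed hfix).2, hg']

end OddMultiples

section HermitianForms

variable {p s l d : ℕ} [Fact p.Prime] {F : Type} [Field F] [Fintype F] [DecidableEq F]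
  [CharP F p] [Algebra (ZMod p) F]

/-- The Dembowski–Ostrom polynomial `t x^(p^s+1) + b x^(p^l+1)`. -/
def doPoly (p s l : ℕ) {F : Type} [Field F] (t b x : F) : F :=
  t * x ^ (p ^ s + 1) + b * x ^ (p ^ l + 1)

/-- The trace-adjoint operator of the bilinear form attached to `doPoly`. -/
def doAdjoint (p s l : ℕ) {F : Type} [Field F] (t b x : F) : F :=
  (t + t ^ p ^ s) * x ^ p ^ s + b * x ^ p ^ l + (b * x) ^ p ^ (2 * s - l)

/-- The number of points where the trace of `doPoly` takes the value `v`. -/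
noncomputable def fiberCount (p s l : ℕ) [Fact p.Prime] {F : Type} [Field F] [Fintype F] [DecidableEq F]
    [Algebra (ZMod p) F] (t b : F) (v : ZMod p) : ℕ :=
  (Finset.univ.filter fun x : F => Algebra.trace (ZMod p) F (doPoly p s l t b x) = v).card

/-- The value of the exponential sum of the trace of `doPoly`, as an integer. -/
noncomputable def expSum (p s l : ℕ) [Fact p.Prime] {F : Type} [Field F] [Fintype F] [DecidableEq F]
    [Algebra (ZMod p) F] (t b : F) : ℤ :=
  fiberCount p s l t b 0 - fiberCount p s l t b 1

theorem trace_pow_char_pow (n : ℕ) (x : F) :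
    Algebra.trace (ZMod p) F (x ^ p ^ n) = Algebra.trace (ZMod p) F x := by
  induction n with
  | zero => simp
  | succ n ih =>
    rw [pow_succ, pow_mul, ← ih]
    have := Algebra.trace_eq_of_algEquiv (FiniteField.frobeniusAlgEquiv (ZMod p) F p)
      (x ^ p ^ n)
    simpa using this

/-- The canonical additive character of `F`. -/
noncomputable def traceChar (p : ℕ) [Fact p.Prime] (F : Type) [Field F] [Algebra (ZMod p) F] :
    AddChar F ℂ :=
  (ZMod.stdAddChar (N := p)).compAddMonoidHom (Algebra.trace (ZMod p) F).toAddMonoidHom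

theorem traceChar_apply (x : F) :
    traceChar p F x = ZMod.stdAddChar (Algebra.trace (ZMod p) F x) := rfl

theorem trace_mul_eq_zero {a : F} (h : ∀ b, Algebra.trace (ZMod p) F (a * b) = 0) : a = 0 := by
  have htr := (traceForm_nondegenerate (ZMod p) F).1 a
  simp_rw [Algebra.traceForm_apply] at htr
  exact htr h

theorem sum_traceChar_mul (a : F) :
    ∑ x : F, traceChar p F (x * a) = if a = 0 then (Fintype.card F : ℂ) else 0 := by
  have hprim : (traceChar p F).IsPrimitive := by
    refine AddChar.IsPrimitive.of_ne_one ?_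
    intro h
    have h1 : ∀ x, Algebra.trace (ZMod p) F x = 0 := by
      intro x
      have h2 : traceChar p F x = 1 := by rw [h]; rfl
      rw [traceChar_apply, ← AddChar.map_zero_eq_one (ZMod.stdAddChar (N := p))] at h2
      exact ZMod.injective_stdAddChar h2
    exact one_ne_zero (trace_mul_eq_zero (p := p) (a := (1 : F)) fun b => h1 _)
  rw [AddChar.sum_mulShift a hprim]
  split_ifs <;> simp

namespace OddMultiples

theorem doPoly_mul_of_similitude {g x t b V : F} (h1 : g ^ (p ^ s + 1) = V)
    (h2 : g ^ (p ^ l + 1) = V) : doPoly p s l t b (g * x) = V * doPoly p s l t b x := by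
  simp only [doPoly, mul_pow, h1, h2]; ring

theorem fiberCount_eq (C : OddMultiples p s l d F) (t b : F) {v : ZMod p} (hv : v ≠ 0) :
    fiberCount p s l t b v = fiberCount p s l t b 1 := by
  obtain ⟨g, hg, h1, h2⟩ := C.exists_similitude hv
  symm
  refine Finset.card_bij' (fun x _ => g * x) (fun x _ => g⁻¹ * x) ?_ ?_ ?_ ?_
  · intro x hx
    simp only [Finset.mem_filter, Finset.mem_univ, true_and] at hx ⊢
    rw [doPoly_mul_of_similitude h1 h2, ← Algebra.smul_def, map_smul, hx, smul_eq_mul, mul_one]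
  · intro x hx
    simp only [Finset.mem_filter, Finset.mem_univ, true_and] at hx ⊢
    obtain ⟨y, rfl⟩ : ∃ y, x = g * y := ⟨g⁻¹ * x, (mul_inv_cancel_left₀ hg x).symm⟩
    rw [doPoly_mul_of_similitude h1 h2, ← Algebra.smul_def, map_smul, smul_eq_mul] at hx
    rw [inv_mul_cancel_left₀ hg]
    exact (mul_eq_left₀ hv).1 hx
  · intro x _; exact inv_mul_cancel_left₀ hg x
  · intro x _; exact mul_inv_cancel_left₀ hg x

theorem sum_fiberCount (C : OddMultiples p s l d F) (t b : F) :
    fiberCount p s l t b 0 + (p - 1) * fiberCount p s l t b 1 = p ^ (2 * s) := by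
  have h := Finset.card_eq_sum_card_fiberwise (s := (Finset.univ : Finset F))
    (t := (Finset.univ : Finset (ZMod p)))
    (f := fun x => Algebra.trace (ZMod p) F (doPoly p s l t b x)) (by intro x _; simp)
  rw [Finset.card_univ, C.card_eq] at h
  rw [h, ← Finset.add_sum_erase _ _ (Finset.mem_univ (0 : ZMod p))]
  congr 1
  rw [Finset.sum_congr rfl (g := fun _ => fiberCount p s l t b 1), Finset.sum_const,
    Finset.card_erase_of_mem (Finset.mem_univ _), Finset.card_univ, ZMod.card, smul_eq_mul]
  intro v hv
  exact C.fiberCount_eq t b (Finset.ne_of_mem_erase hv)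

theorem mul_fiberCount_zero (C : OddMultiples p s l d F) (t b : F) :
    (p : ℤ) * fiberCount p s l t b 0 = (p : ℤ) ^ (2 * s) + (p - 1) * expSum p s l t b := by
  have h := C.sum_fiberCount t b
  have h1 : ((p - 1 : ℕ) : ℤ) = p - 1 := by
    rw [Nat.cast_sub (Fact.out : p.Prime).one_le]; simp
  zify at h
  rw [h1] at h
  rw [expSum]; linear_combination h

theorem mul_fiberCount_of_ne (C : OddMultiples p s l d F) (t b : F) {v : ZMod p} (hv : v ≠ 0) :
    (p : ℤ) * fiberCount p s l t b v = (p : ℤ) ^ (2 * s) - expSum p s l t b := by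
  have h := C.mul_fiberCount_zero t b
  rw [C.fiberCount_eq t b hv]
  rw [expSum] at h ⊢; linear_combination h

theorem dvd_card_of_saturated (C : OddMultiples p s l d F) (X : Finset F) (h0 : (0 : F) ∉ X)
    (hX : ∀ x ∈ X, ∀ y, y ^ (p ^ d + 1) = x ^ (p ^ d + 1) → y ∈ X) :
    p ^ d + 1 ∣ X.card := by
  rw [Finset.card_eq_sum_card_image (fun x => x ^ (p ^ d + 1)) X]
  refine Finset.dvd_sum fun z hz => ?_
  obtain ⟨x, hx, rfl⟩ := Finset.mem_image.1 hz
  have hx0 : x ≠ 0 := fun h => h0 (h ▸ hx)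
  rw [show (X.filter fun y => y ^ (p ^ d + 1) = x ^ (p ^ d + 1))
      = Finset.univ.filter fun y => y ^ (p ^ d + 1) = x ^ (p ^ d + 1) from ?_,
    card_pow_eq_pow_of_dvd C.dvd_card_sub_one hx0]
  ext y
  simp only [Finset.mem_filter, Finset.mem_univ, true_and, and_iff_right_iff_imp]
  exact hX x hx y

theorem doPoly_congr (C : OddMultiples p s l d F) (t b : F) {x y : F} (hx : x ≠ 0)
    (h : y ^ (p ^ d + 1) = x ^ (p ^ d + 1)) : doPoly p s l t b y = doPoly p s l t b x := by
  obtain ⟨h1, h2⟩ := (C.pow_eq_pow_iff hx).2 h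
  rw [doPoly, doPoly, h1, h2]

theorem dvd_expSum_sub_one (C : OddMultiples p s l d F) (t b : F) :
    (p : ℤ) ^ d + 1 ∣ expSum p s l t b - 1 := by
  have hzero : doPoly p s l t b 0 = 0 := by simp [doPoly]
  have key : ∀ v : ZMod p, p ^ d + 1 ∣ ((Finset.univ.filter fun x : F =>
      Algebra.trace (ZMod p) F (doPoly p s l t b x) = v).erase 0).card := by
    intro v
    refine C.dvd_card_of_saturated _ (Finset.notMem_erase _ _) ?_
    intro x hx y hxy
    simp only [Finset.mem_erase, Finset.mem_filter, Finset.mem_univ, true_and] at hx ⊢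
    refine ⟨?_, ?_⟩
    · rintro rfl
      rw [zero_pow (by omega)] at hxy
      exact pow_ne_zero _ hx.1 hxy.symm
    · rw [C.doPoly_congr t b hx.1 hxy, hx.2]
  have k0 := key 0
  have k1 := key 1
  rw [Finset.card_erase_of_mem (by simp [hzero])] at k0
  rw [Finset.erase_eq_of_notMem (by simp [hzero])] at k1
  have hpos : 1 ≤ fiberCount p s l t b 0 := Finset.card_pos.2 ⟨0, by simp [hzero]⟩
  change _ ∣ fiberCount p s l t b 0 - 1 at k0
  change _ ∣ fiberCount p s l t b 1 at k1
  zify [hpos] at k0 k1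
  rw [expSum]
  have := dvd_sub k0 k1
  rwa [show ((fiberCount p s l t b 0 : ℤ) - 1 - fiberCount p s l t b 1)
    = fiberCount p s l t b 0 - fiberCount p s l t b 1 - 1 by ring] at this

theorem sum_traceChar_doPoly (C : OddMultiples p s l d F) (t b : F) :
    ∑ x : F, traceChar p F (doPoly p s l t b x) = expSum p s l t b := by
  have h := Finset.sum_fiberwise (Finset.univ : Finset F)
    (fun x => Algebra.trace (ZMod p) F (doPoly p s l t b x))
    (fun x => traceChar p F (doPoly p s l t b x))
  rw [← h]
  have h2 : ∀ v : ZMod p, ∑ x ∈ Finset.univ.filter (fun x : F =>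
      Algebra.trace (ZMod p) F (doPoly p s l t b x) = v), traceChar p F (doPoly p s l t b x)
      = fiberCount p s l t b v * ZMod.stdAddChar v := by
    intro v
    rw [Finset.sum_congr rfl (g := fun _ => ZMod.stdAddChar v), Finset.sum_const, nsmul_eq_mul,
      fiberCount]
    intro x hx
    rw [traceChar_apply, (Finset.mem_filter.1 hx).2]
  rw [Finset.sum_congr rfl fun v _ => h2 v]
  have h3 : ∑ v : ZMod p, ZMod.stdAddChar v = (0 : ℂ) := by
    rw [AddChar.sum_eq_zero_iff_ne_zero]
    have h4 := ZMod.isPrimitive_stdAddChar p (one_ne_zero)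
    rwa [AddChar.mulShift_one] at h4
  rw [← Finset.add_sum_erase _ _ (Finset.mem_univ (0 : ZMod p))] at h3 ⊢
  rw [Finset.sum_congr rfl (g := fun v => (fiberCount p s l t b 1 : ℂ) * ZMod.stdAddChar v),
    ← Finset.mul_sum, expSum]
  · rw [AddChar.map_zero_eq_one] at h3 ⊢
    push_cast
    linear_combination (fiberCount p s l t b 1 : ℂ) * h3
  · intro v hv
    rw [C.fiberCount_eq t b (Finset.ne_of_mem_erase hv)]

theorem sum_traceChar_neg_doPoly (C : OddMultiples p s l d F) (t b : F) :
    ∑ x : F, traceChar p F (-doPoly p s l t b x) = expSum p s l t b := by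
  obtain ⟨g, hg, h1, h2⟩ := C.exists_similitude (v := -1) (by simp)
  rw [← C.sum_traceChar_doPoly, ← Equiv.sum_comp (Equiv.mulLeft₀ g hg)]
  refine Finset.sum_congr rfl fun x _ => ?_
  rw [Equiv.mulLeft₀_apply, doPoly_mul_of_similitude h1 h2]
  simp

theorem trace_polar (C : OddMultiples p s l d F) (t b x y : F) :
    Algebra.trace (ZMod p) F (t * (x ^ p ^ s * y + x * y ^ p ^ s)
      + b * (x ^ p ^ l * y + x * y ^ p ^ l))
      = Algebra.trace (ZMod p) F (y * doAdjoint p s l t b x) := by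
  have h1 : Algebra.trace (ZMod p) F (t * (x * y ^ p ^ s))
      = Algebra.trace (ZMod p) F (t ^ p ^ s * x ^ p ^ s * y) := by
    rw [← trace_pow_char_pow s (t * (x * y ^ p ^ s))]
    congr 1
    have := C.pow_card y
    rw [two_mul, pow_add, pow_mul] at this
    rw [mul_pow, mul_pow, this, mul_assoc]
  have h2 : Algebra.trace (ZMod p) F (b * (x * y ^ p ^ l))
      = Algebra.trace (ZMod p) F ((b * x) ^ p ^ (2 * s - l) * y) := by
    rw [← trace_pow_char_pow (2 * s - l) (b * (x * y ^ p ^ l))]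
    congr 1
    have := C.pow_card y
    rw [← Nat.add_sub_cancel' C.l_le, pow_add, pow_mul] at this
    rw [← mul_assoc, mul_pow (b * x), this]
  rw [mul_add, mul_add, map_add, map_add, map_add, h1, h2, doAdjoint]
  simp only [← map_add]
  congr 1; ring

theorem trace_doPoly_add (C : OddMultiples p s l d F) (t b x y : F) :
    Algebra.trace (ZMod p) F (doPoly p s l t b (x + y))
      = Algebra.trace (ZMod p) F (doPoly p s l t b x)
        + Algebra.trace (ZMod p) F (doPoly p s l t b y)
        + Algebra.trace (ZMod p) F (y * doAdjoint p s l t b x) := by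
  rw [← C.trace_polar, ← map_add, ← map_add]
  congr 1
  simp only [doPoly, pow_succ, add_pow_char_pow]
  ring

theorem two_ne_zero (C : OddMultiples p s l d F) : (2 : ZMod p) ≠ 0 := by
  have := C.two_lt
  intro h
  have h3 : ((2 : ℕ) : ZMod p) = 0 := by exact_mod_cast h
  rw [ZMod.natCast_eq_zero_iff] at h3
  exact absurd (Nat.le_of_dvd (by norm_num) h3) (by omega)

theorem trace_doPoly_of_doAdjoint_eq_zero (C : OddMultiples p s l d F) {t b x : F}
    (h : doAdjoint p s l t b x = 0) : Algebra.trace (ZMod p) F (doPoly p s l t b x) = 0 := by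
  have h1 := C.trace_polar t b x x
  rw [h, mul_zero, map_zero, show t * (x ^ p ^ s * x + x * x ^ p ^ s)
      + b * (x ^ p ^ l * x + x * x ^ p ^ l) = doPoly p s l t b x + doPoly p s l t b x by
    simp only [doPoly, pow_succ]; ring, map_add, ← two_mul] at h1
  exact (mul_eq_zero.1 h1).resolve_left C.two_ne_zero

theorem expSum_sq (C : OddMultiples p s l d F) (t b : F) :
    expSum p s l t b ^ 2 = (p : ℤ) ^ (2 * s)
      * (Finset.univ.filter fun x : F => doAdjoint p s l t b x = 0).card := by
  have h : (expSum p s l t b : ℂ) ^ 2 = (p : ℂ) ^ (2 * s)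
      * (Finset.univ.filter fun x : F => doAdjoint p s l t b x = 0).card := by
    rw [sq]
    nth_rewrite 2 [← C.sum_traceChar_neg_doPoly]
    rw [← C.sum_traceChar_doPoly, Finset.sum_mul_sum, Finset.sum_comm]
    have h1 : ∀ y : F, ∑ x : F, traceChar p F (doPoly p s l t b x)
        * traceChar p F (-doPoly p s l t b y) = ∑ x : F, traceChar p F (doPoly p s l t b x)
        * traceChar p F (y * doAdjoint p s l t b x) := by
      intro y
      rw [← Equiv.sum_comp (Equiv.addRight y)]
      refine Finset.sum_congr rfl fun x _ => ?_
      simp only [Equiv.coe_addRight, traceChar_apply, ← AddChar.map_add_eq_mul, map_neg]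
      rw [C.trace_doPoly_add]
      congr 1; ring
    rw [Finset.sum_congr rfl fun y _ => h1 y, Finset.sum_comm]
    simp only [← Finset.mul_sum, sum_traceChar_mul]
    rw [Finset.card_filter]
    push_cast
    rw [Finset.mul_sum]
    refine Finset.sum_congr rfl fun x _ => ?_
    split_ifs with hx
    · rw [traceChar_apply, C.trace_doPoly_of_doAdjoint_eq_zero hx, AddChar.map_zero_eq_one,
        C.card_eq]
      push_cast; ring
    · simp
  exact_mod_cast h

theorem doAdjoint_add (C : OddMultiples p s l d F) (t b x y : F) :
    doAdjoint p s l t b (x + y) = doAdjoint p s l t b x + doAdjoint p s l t b y := by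
  simp only [doAdjoint, mul_add, add_pow_char_pow]; ring

/-- `doAdjoint` as a linear map over the prime field. -/
def doAdjointHom (C : OddMultiples p s l d F) (t b : F) : F →ₗ[ZMod p] F :=
  (AddMonoidHom.mk' (doAdjoint p s l t b) (C.doAdjoint_add t b)).toZModLinearMap p

theorem doAdjointHom_apply (C : OddMultiples p s l d F) (t b x : F) :
    C.doAdjointHom t b x = doAdjoint p s l t b x := rfl

theorem card_doAdjoint_zero_dvd (C : OddMultiples p s l d F) (t b : F) :
    (Finset.univ.filter fun x : F => doAdjoint p s l t b x = 0).card ∣ p ^ (2 * s) := by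
  classical
  have h := AddSubgroup.card_addSubgroup_dvd_card (C.doAdjointHom t b).ker.toAddSubgroup
  rw [Nat.card_eq_fintype_card, Nat.card_eq_fintype_card, C.card_eq] at h
  convert h using 1
  rw [Fintype.card_subtype]
  refine congrArg Finset.card (Finset.ext fun x => ?_)
  simp only [Finset.mem_filter, Finset.mem_univ, true_and]
  rfl

theorem card_doAdjoint_zero_le (C : OddMultiples p s l d F) {t b : F}
    (h : ¬ (t + t ^ p ^ s = 0 ∧ b = 0)) :
    (Finset.univ.filter fun x : F => doAdjoint p s l t b x = 0).card ≤ p ^ (4 * d) := by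
  have hp := (Fact.out : p.Prime).pos
  by_cases hb : b = 0
  · have ht : t + t ^ p ^ s ≠ 0 := fun h' => h ⟨h', hb⟩
    refine le_trans (Finset.card_le_card (t := {0}) ?_) ?_
    · intro x hx
      simp only [Finset.mem_filter, Finset.mem_univ, true_and, Finset.mem_singleton, doAdjoint,
        hb, zero_mul, add_zero] at hx ⊢
      rw [zero_pow (pow_ne_zero _ hp.ne'), add_zero] at hx
      exact eq_zero_of_pow_eq_zero ((mul_eq_zero.1 hx).resolve_left ht)
    · simpa using Nat.one_le_pow _ _ hp
  · set σ := iterateFrobenius F p (s + l) with hσ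
    have hσx : ∀ x, σ x = x ^ p ^ (s + l) := fun x => iterateFrobenius_def p (s + l) x
    have hfix : (Finset.univ.filter fun x : F => σ x = x).card ≤ p ^ (2 * d) := by
      refine le_trans (Finset.card_le_card ?_) (card_pow_eq_self_le (F := F)
        (Nat.one_lt_pow (by have := C.d_pos; omega) (Fact.out : p.Prime).one_lt))
      intro x hx
      simp only [Finset.mem_filter, Finset.mem_univ, true_and, hσx] at hx ⊢
      exact C.fixed_of_fixed_add hx
    have hinv : ∀ x : F, (x ^ p ^ (2 * s - l)) ^ p ^ l = x := fun x => by
      rw [← pow_mul, ← pow_add, Nat.sub_add_cancel C.l_le, C.pow_card]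
    have := card_linear_recurrence_two_le σ (t + t ^ p ^ s) (b ^ p ^ (2 * s - l)) hb
    refine le_trans ?_ (this.trans ((Nat.pow_le_pow_left hfix 2).trans_eq ?_))
    · refine Finset.card_le_card_of_injOn (fun x => x ^ p ^ (2 * s - l)) ?_ ?_
      · intro x hx
        simp only [Finset.coe_filter, Finset.mem_univ, true_and, Set.mem_ofPred_eq, hσx] at hx ⊢
        rw [doAdjoint] at hx
        have e1 : (x ^ p ^ (2 * s - l)) ^ p ^ (s + l) = x ^ p ^ s := by
          rw [add_comm s l, pow_add, pow_mul, hinv]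
        have e2 : (x ^ p ^ s) ^ p ^ (s + l) = x ^ p ^ l := by
          have := C.pow_card x
          rw [two_mul, pow_add, pow_mul] at this
          rw [pow_add, pow_mul, this]
        rw [e1, e2, ← mul_pow]
        linear_combination hx
      · intro x _ y _ hxy
        rw [← hinv x, ← hinv y]
        exact congrArg (· ^ p ^ l) hxy
    · rw [← pow_mul]; congr 1; ring

theorem exists_adjoint_preimage_or (C : OddMultiples p s l d F) (t b c : F) :
    (∃ u, ∀ x, Algebra.trace (ZMod p) F (c * x)
      = Algebra.trace (ZMod p) F (x * doAdjoint p s l t b u)) ∨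
    ∃ r, doAdjoint p s l t b r = 0 ∧ Algebra.trace (ZMod p) F (c * r) ≠ 0 := by
  by_cases h : ∃ r, doAdjoint p s l t b r = 0 ∧ Algebra.trace (ZMod p) F (c * r) ≠ 0
  · exact Or.inr h
  · left
    push Not at h
    have h1 : Algebra.traceForm (ZMod p) F c ∈ (C.doAdjointHom t b).ker.dualAnnihilator := by
      rw [Submodule.mem_dualAnnihilator]
      intro r hr
      exact h r hr
    rw [← LinearMap.range_dualMap_eq_dualAnnihilator_ker] at h1
    obtain ⟨φ, hφ⟩ := h1
    obtain ⟨u, hu⟩ := ((Algebra.traceForm (ZMod p) F).toDual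
      (traceForm_nondegenerate (ZMod p) F)).surjective φ
    refine ⟨u, fun x => ?_⟩
    have h2 : Algebra.trace (ZMod p) F (c * x) = φ (doAdjoint p s l t b x) := by
      have := LinearMap.congr_fun hφ x
      exact this.symm
    rw [h2, ← hu, LinearMap.BilinForm.toDual_def, Algebra.traceForm_apply,
      ← C.trace_polar t b x u, ← C.trace_polar t b u x]
    congr 1; ring

theorem eq_of_dvd_sign_mul_pow_add_one {p d r : ℕ} (hp : 2 < p) (hr : r < d) {δ : ℤ}
    (hδ : δ = 1 ∨ δ = -1) (h : (p : ℤ) ^ d + 1 ∣ δ * p ^ r + 1) : δ = -1 ∧ r = 0 := by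
  have h1 : (p : ℤ) ^ r < p ^ d := by
    exact_mod_cast Nat.pow_lt_pow_right (by omega) hr
  have h2 : (1 : ℤ) ≤ p ^ r := by exact_mod_cast Nat.one_le_pow _ _ (by omega)
  have h3 : δ * (p : ℤ) ^ r + 1 = 0 := by
    apply Int.eq_zero_of_abs_lt_dvd h
    rcases hδ with rfl | rfl <;> rw [abs_lt] <;> constructor <;> linarith
  rcases hδ with rfl | rfl
  · linarith
  · refine ⟨rfl, ?_⟩
    have h4 : (p : ℤ) ^ r = 1 := by linarith
    have h5 : p ^ r = 1 := by exact_mod_cast h4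
    by_contra h0
    have := Nat.one_lt_pow h0 (show 1 < p by omega)
    omega

theorem sign_and_exponent_of_dvd {p d i : ℕ} (hp : 2 < p) (hd : 0 < d) (hi : i ≤ 2 * d) {δ : ℤ}
    (hδ : δ = 1 ∨ δ = -1) (h : (p : ℤ) ^ d + 1 ∣ δ * p ^ i + 1) :
    (δ = -1 ∧ i = 0) ∨ (δ = 1 ∧ i = d) ∨ (δ = -1 ∧ i = 2 * d) := by
  rcases Nat.lt_or_ge i d with h1 | h1
  · exact Or.inl (eq_of_dvd_sign_mul_pow_add_one hp h1 hδ h)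
  · obtain ⟨r, rfl⟩ := Nat.exists_eq_add_of_le h1
    have h2 : (p : ℤ) ^ d + 1 ∣ (-δ) * p ^ r + 1 := by
      have h3 := dvd_sub h (Dvd.intro (δ * (p : ℤ) ^ r) rfl)
      rwa [show δ * (p : ℤ) ^ (d + r) + 1 - (p ^ d + 1) * (δ * p ^ r) = (-δ) * p ^ r + 1 by
        rw [pow_add]; ring] at h3
    rcases Nat.lt_or_ge r d with h3 | h3
    · obtain ⟨h4, h5⟩ := eq_of_dvd_sign_mul_pow_add_one hp h3
        (by rcases hδ with rfl | rfl <;> simp) h2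
      right; left; exact ⟨by linarith, by omega⟩
    · obtain rfl : r = d := by omega
      rcases hδ with rfl | rfl
      · exfalso
        have h4 := dvd_add h2 (dvd_refl _)
        rw [show (-1 : ℤ) * (p : ℤ) ^ r + 1 + (p ^ r + 1) = 2 by ring] at h4
        have h5 : (p : ℤ) ≤ p ^ r := by exact_mod_cast Nat.le_self_pow hd.ne' p
        have := Int.le_of_dvd (by norm_num) h4
        have : (2 : ℤ) < p := by exact_mod_cast hp
        linarith
      · right; right; exact ⟨rfl, by omega⟩

theorem expSum_cases (C : OddMultiples p s l d F) {t b : F}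
    (h : ¬ (t + t ^ p ^ s = 0 ∧ b = 0)) :
    expSum p s l t b = -(p : ℤ) ^ s ∨ expSum p s l t b = (p : ℤ) ^ s * p ^ d ∨
      expSum p s l t b = -((p : ℤ) ^ s * (p ^ d) ^ 2) := by
  have hp : p.Prime := Fact.out
  set T := expSum p s l t b with hT
  set k := (Finset.univ.filter fun x : F => doAdjoint p s l t b x = 0).card with hk
  have hsq : T.natAbs ^ 2 = p ^ (2 * s) * k := by
    have := C.expSum_sq t b
    rw [← hT, ← hk] at this
    zify
    rw [sq_abs, this]
  have hkle : k ≤ p ^ (4 * d) := C.card_doAdjoint_zero_le h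
  obtain ⟨j, -, hj⟩ : ∃ j ≤ 2 * s + 2 * s, T.natAbs = p ^ j := by
    rw [← Nat.dvd_prime_pow hp]
    refine (Dvd.intro_left (T.natAbs ^ 1) ?_ : T.natAbs ∣ T.natAbs ^ 2).trans ?_
    · ring
    · rw [hsq, pow_add]
      exact Nat.mul_dvd_mul_left _ (C.card_doAdjoint_zero_dvd t b)
  rw [hj, ← pow_mul] at hsq
  have hsj : 2 * s ≤ j * 2 := (Nat.pow_dvd_pow_iff_le_right hp.one_lt).1 (Dvd.intro _ hsq.symm)
  obtain ⟨i, rfl⟩ : ∃ i, j = s + i := ⟨j - s, by omega⟩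
  have hi : i ≤ 2 * d := by
    have h1 : p ^ ((s + i) * 2) ≤ p ^ (2 * s + 4 * d) := by
      rw [hsq, pow_add]; exact Nat.mul_le_mul_left _ hkle
    have := (Nat.pow_le_pow_iff_right hp.one_lt).1 h1
    omega
  obtain ⟨ε, hε, hTε⟩ : ∃ ε : ℤ, (ε = 1 ∨ ε = -1) ∧ T = ε * p ^ (s + i) := by
    rcases Int.natAbs_eq T with h1 | h1
    · exact ⟨1, Or.inl rfl, by rw [h1, hj]; push_cast; ring⟩
    · exact ⟨-1, Or.inr rfl, by rw [h1, hj]; push_cast; ring⟩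
  have hPs : (p : ℤ) ^ d + 1 ∣ p ^ s + 1 := by
    obtain ⟨n, hn⟩ := C.s_eq
    have := Odd.add_dvd_pow_add_pow ((p : ℤ) ^ d) 1 (n := 2 * n + 1) ⟨n, rfl⟩
    rwa [one_pow, ← pow_mul, show d * (2 * n + 1) = s by rw [hn]; ring] at this
  have hdvd : (p : ℤ) ^ d + 1 ∣ ε * p ^ i + 1 := by
    have h1 := C.dvd_expSum_sub_one t b
    rw [← hT, hTε] at h1
    have h2 := dvd_sub (hPs.mul_right (ε * p ^ i)) h1
    rwa [show ((p : ℤ) ^ s + 1) * (ε * p ^ i) - (ε * p ^ (s + i) - 1) = ε * p ^ i + 1 by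
      rw [pow_add]; ring] at h2
  rcases sign_and_exponent_of_dvd C.two_lt C.d_pos hi hε hdvd with
    ⟨rfl, rfl⟩ | ⟨rfl, rfl⟩ | ⟨rfl, rfl⟩
  · left; rw [hTε]; ring
  · right; left; rw [hTε]; ring
  · right; right; rw [hTε]; ring

theorem sum_sum_traceChar (C : OddMultiples p s l d F) (u v : F) :
    ∑ t : F, ∑ b : F, traceChar p F (t * u + b * v)
      = if u = 0 ∧ v = 0 then ((p : ℂ) ^ (2 * s)) ^ 2 else 0 := by
  simp only [AddChar.map_add_eq_mul, ← Finset.mul_sum, ← Finset.sum_mul, sum_traceChar_mul]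
  by_cases hu : u = 0 <;> by_cases hv : v = 0 <;> simp [hu, hv, C.card_eq, sq]

theorem sum_expSum (C : OddMultiples p s l d F) :
    ∑ t : F, ∑ b : F, expSum p s l t b = ((p : ℤ) ^ (2 * s)) ^ 2 := by
  have h : ∑ t : F, ∑ b : F, (expSum p s l t b : ℂ) = ((p : ℂ) ^ (2 * s)) ^ 2 := by
    simp only [← C.sum_traceChar_doPoly]
    rw [Finset.sum_congr rfl fun t _ => Finset.sum_comm, Finset.sum_comm]
    simp only [doPoly, C.sum_sum_traceChar]
    simp
  exact_mod_cast h

theorem card_pow_eq_pow_pair (C : OddMultiples p s l d F) (x : F) :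
    (Finset.univ.filter fun y : F =>
      x ^ (p ^ s + 1) - y ^ (p ^ s + 1) = 0 ∧ x ^ (p ^ l + 1) - y ^ (p ^ l + 1) = 0).card
      = if x = 0 then 1 else p ^ d + 1 := by
  split_ifs with hx
  · subst hx
    rw [Finset.card_eq_one]
    refine ⟨0, ?_⟩
    ext y
    simp
  · rw [← card_pow_eq_pow_of_dvd C.dvd_card_sub_one hx]
    congr 1
    ext y
    simp only [Finset.mem_filter, Finset.mem_univ, true_and, sub_eq_zero]
    rw [← C.pow_eq_pow_iff hx, eq_comm, @eq_comm _ (x ^ (p ^ l + 1))]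

theorem sum_expSum_sq (C : OddMultiples p s l d F) :
    ∑ t : F, ∑ b : F, expSum p s l t b ^ 2
      = ((p : ℤ) ^ (2 * s)) ^ 2 * (1 + ((p : ℤ) ^ (2 * s) - 1) * (p ^ d + 1)) := by
  have h : ∑ t : F, ∑ b : F, (expSum p s l t b : ℂ) ^ 2
      = ((p : ℂ) ^ (2 * s)) ^ 2 * (1 + ((p : ℂ) ^ (2 * s) - 1) * (p ^ d + 1)) := by
    have h1 : ∀ t b : F, (expSum p s l t b : ℂ) ^ 2 = ∑ x : F, ∑ y : F,
        traceChar p F (t * (x ^ (p ^ s + 1) - y ^ (p ^ s + 1))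
          + b * (x ^ (p ^ l + 1) - y ^ (p ^ l + 1))) := by
      intro t b
      rw [sq]
      nth_rewrite 2 [← C.sum_traceChar_neg_doPoly]
      rw [← C.sum_traceChar_doPoly, Finset.sum_mul_sum]
      refine Finset.sum_congr rfl fun x _ => Finset.sum_congr rfl fun y _ => ?_
      rw [← AddChar.map_add_eq_mul]
      congr 1
      simp only [doPoly]; ring
    simp only [h1]
    calc _ = ∑ x : F, ∑ y : F, ∑ t : F, ∑ b : F,
          traceChar p F (t * (x ^ (p ^ s + 1) - y ^ (p ^ s + 1))
          + b * (x ^ (p ^ l + 1) - y ^ (p ^ l + 1))) := by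
          rw [Finset.sum_congr rfl fun t _ => Finset.sum_comm, Finset.sum_comm]
          refine Finset.sum_congr rfl fun x _ => ?_
          rw [Finset.sum_congr rfl fun t _ => Finset.sum_comm, Finset.sum_comm]
      _ = ∑ x : F, ((p : ℂ) ^ (2 * s)) ^ 2 * ((if x = 0 then 1 else p ^ d + 1 : ℕ) : ℂ) := by
          refine Finset.sum_congr rfl fun x _ => ?_
          simp only [C.sum_sum_traceChar]
          rw [← C.card_pow_eq_pow_pair, ← Finset.sum_filter, Finset.sum_const, nsmul_eq_mul,
            mul_comm]
      _ = _ := by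
          rw [← Finset.mul_sum, ← Finset.add_sum_erase _ _ (Finset.mem_univ (0 : F))]
          rw [Finset.sum_congr rfl (g := fun _ => ((p ^ d + 1 : ℕ) : ℂ)), Finset.sum_const,
            Finset.card_erase_of_mem (Finset.mem_univ _), Finset.card_univ, C.card_eq,
            nsmul_eq_mul, Nat.cast_sub (Nat.one_le_pow _ _ (Fact.out : p.Prime).pos)]
          · simp
          · intro x hx
            rw [if_neg (Finset.ne_of_mem_erase hx)]
  exact_mod_cast h

theorem half_add_half_pow (C : OddMultiples p s l d F) {a : F} (ha : a ^ p ^ s = a) :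
    a / 2 + (a / 2) ^ p ^ s = a := by
  have h1 : algebraMap (ZMod p) F 2 = 2 := map_ofNat _ 2
  have h2 : (2 : F) ≠ 0 := by
    rw [← h1]
    exact (map_ne_zero (algebraMap (ZMod p) F)).2 C.two_ne_zero
  have h3 : (2 : F) ^ p ^ s = 2 := by
    have := congrArg (algebraMap (ZMod p) F) (ZMod.pow_card_pow (n := s) (2 : ZMod p))
    rwa [map_pow, h1] at this
  rw [div_pow, ha, h3]
  field_simp; norm_num

theorem card_add_pow_fiber (C : OddMultiples p s l d F) {a : F} (ha : a ^ p ^ s = a) :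
    (Finset.univ.filter fun t : F => t + t ^ p ^ s = a).card = p ^ s := by
  have hp : p.Prime := Fact.out
  set K := Finset.univ.filter fun x : F => x ^ p ^ s = x with hK
  have hKle : K.card ≤ p ^ s := card_pow_eq_self_le (Nat.one_lt_pow
    (by have := C.d_lt; omega) hp.one_lt)
  set k := (Finset.univ.filter fun t : F => t + t ^ p ^ s = 0).card with hk
  have hkle : k ≤ p ^ s := by
    have := card_linear_recurrence_one_le (iterateFrobenius F p s) (A := (1 : F)) 1 one_ne_zero
    simp only [iterateFrobenius_def, one_mul] at this
    refine le_trans (le_of_eq ?_) (this.trans hKle)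
    rw [hk]; congr 1; ext t; simp [add_comm]
  set φ : F →+ F := AddMonoidHom.mk' (fun t => t + t ^ p ^ s)
    (fun x y => by rw [add_pow_char_pow]; ring) with hφ
  have hfib : ∀ a ∈ K, (Finset.univ.filter fun t : F => t + t ^ p ^ s = a).card = k := by
    intro a ha
    have ha' : a ^ p ^ s = a := by simpa [hK] using ha
    exact AddMonoidHom.card_fiber_eq_of_mem_range φ ⟨a / 2, C.half_add_half_pow ha'⟩
      ⟨0, map_zero φ⟩
  have hmaps : Set.MapsTo (fun t : F => t + t ^ p ^ s) (Finset.univ : Finset F) K := by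
    intro t _
    have := C.pow_card t
    rw [two_mul, pow_add, pow_mul] at this
    simp only [hK, Finset.coe_filter, Finset.mem_univ, true_and, Set.mem_ofPred_eq,
      add_pow_char_pow, this]
    ring
  have htot := Finset.card_eq_sum_card_fiberwise hmaps
  rw [Finset.sum_congr rfl hfib, Finset.sum_const, smul_eq_mul, Finset.card_univ, C.card_eq,
    two_mul, pow_add] at htot
  rw [hfib a (by simpa [hK] using ha)]
  have hpos : 0 < p ^ s := pow_pos hp.pos _
  nlinarith [Nat.mul_le_mul_right k hKle]

theorem expSum_congr (C : OddMultiples p s l d F) {t t' : F} (b : F)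
    (h : t + t ^ p ^ s = t' + t' ^ p ^ s) : expSum p s l t b = expSum p s l t' b := by
  have key : ∀ x, Algebra.trace (ZMod p) F (doPoly p s l t b x)
      = Algebra.trace (ZMod p) F (doPoly p s l t' b x) := by
    intro x
    rw [← sub_eq_zero, ← map_sub]
    have h1 : doPoly p s l t b x - doPoly p s l t' b x = (t - t') * x ^ (p ^ s + 1) := by
      simp only [doPoly]; ring
    have hx := C.pow_card x
    rw [two_mul, pow_add, pow_mul] at hx
    have h2 : ((t - t') * x ^ (p ^ s + 1)) ^ p ^ s = -((t - t') * x ^ (p ^ s + 1)) := by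
      have : (x ^ (p ^ s + 1)) ^ p ^ s = x ^ (p ^ s + 1) := by
        rw [pow_succ, mul_pow, hx, mul_comm]
      rw [mul_pow, this, sub_pow_char_pow]
      linear_combination x ^ (p ^ s + 1) * h
    rw [h1]
    have h3 := trace_pow_char_pow (p := p) s ((t - t') * x ^ (p ^ s + 1))
    rw [h2, map_neg] at h3
    have h4 : (2 : ZMod p) * Algebra.trace (ZMod p) F ((t - t') * x ^ (p ^ s + 1)) = 0 := by
      linear_combination -h3
    exact (mul_eq_zero.1 h4).resolve_left C.two_ne_zero
  simp only [expSum, fiberCount, key]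

theorem expSum_of_zero (C : OddMultiples p s l d F) {t b : F} (h : t + t ^ p ^ s = 0)
    (hb : b = 0) : expSum p s l t b = (p : ℤ) ^ (2 * s) := by
  have hp := (Fact.out : p.Prime)
  have h1 : expSum p s l t b = expSum p s l 0 (0 : F) := by
    rw [hb]; apply C.expSum_congr
    rw [h, zero_pow (pow_ne_zero _ hp.ne_zero), add_zero]
  have h2 := C.sum_traceChar_doPoly 0 0
  simp only [doPoly, zero_mul, add_zero, AddChar.map_zero_eq_one, Finset.sum_const,
    Finset.card_univ, C.card_eq, nsmul_eq_mul, mul_one] at h2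
  rw [h1]
  exact_mod_cast h2.symm

theorem card_pairs_expSum_eq (C : OddMultiples p s l d F) :
    ((Finset.univ.filter fun w : F × F => expSum p s l w.1 w.2 = -(p : ℤ) ^ s).card : ℤ)
      * (((p : ℤ) ^ d + 1) * ((p ^ d) ^ 2 - 1))
      = p ^ s * (p ^ s - 1) * ((p ^ s) ^ 2 * ((p ^ d) ^ 3 - p ^ d - 1)
        + p ^ s * ((p ^ d) ^ 3 - (p ^ d) ^ 2) + (p ^ d) ^ 3) := by
  have hp := (Fact.out : p.Prime)
  set P : ℤ := (p : ℤ) ^ s with hP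
  set Q : ℤ := (p : ℤ) ^ d with hQ
  have hP0 : 0 < P := pow_pos (by exact_mod_cast hp.pos) _
  have hQ0 : 0 < Q := pow_pos (by exact_mod_cast hp.pos) _
  have hq : (p : ℤ) ^ (2 * s) = P ^ 2 := by rw [hP]; ring
  set M := (Finset.univ.filter fun w : F × F => expSum p s l w.1 w.2 = -P).card with hM
  have hZ : (Finset.univ.filter fun w : F × F => w.1 + w.1 ^ p ^ s = 0 ∧ w.2 = 0).card
      = p ^ s := by
    refine Eq.trans ?_ (C.card_add_pow_fiber (a := 0) (zero_pow (pow_ne_zero _ hp.ne_zero)))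
    refine Finset.card_bij' (fun w _ => w.1) (fun t _ => (t, 0)) ?_ ?_ ?_ ?_
    · intro w hw; simp at hw ⊢; exact hw.1
    · intro t ht; simp at ht ⊢; exact ht
    · rintro ⟨t, b⟩ hw; simp at hw ⊢; exact hw.2.symm
    · intro t _; rfl
  have hpt : ∀ w : F × F, (expSum p s l w.1 w.2 - P * Q) * (expSum p s l w.1 w.2 + P * Q ^ 2)
      = (if expSum p s l w.1 w.2 = -P then (-P - P * Q) * (-P + P * Q ^ 2) else 0)
        + (if w.1 + w.1 ^ p ^ s = 0 ∧ w.2 = 0 then (P ^ 2 - P * Q) * (P ^ 2 + P * Q ^ 2)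
          else 0) := by
    intro w
    by_cases hw : w.1 + w.1 ^ p ^ s = 0 ∧ w.2 = 0
    · have hT := C.expSum_of_zero hw.1 hw.2
      rw [if_pos hw, hT, hq, if_neg (by nlinarith), zero_add]
    · rw [if_neg hw, add_zero]
      rcases C.expSum_cases hw with h | h | h
      · rw [h, if_pos rfl]
      · rw [h, if_neg (by nlinarith)]; ring
      · rw [h]
        split_ifs with h'
        · rw [← hP, ← hQ] at h'; rw [← hP, ← hQ, h']
        · ring
  have hsum := Finset.sum_congr (rfl : (Finset.univ : Finset (F × F)) = _) fun w _ => hpt w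
  rw [Finset.sum_add_distrib, ← Finset.sum_filter, ← Finset.sum_filter, Finset.sum_const,
    Finset.sum_const, hZ, ← hM, nsmul_eq_mul, nsmul_eq_mul, Fintype.sum_prod_type] at hsum
  have hl : ∀ t b : F, (expSum p s l t b - P * Q) * (expSum p s l t b + P * Q ^ 2)
      = expSum p s l t b ^ 2 + (P * Q ^ 2 - P * Q) * expSum p s l t b
        - P ^ 2 * Q ^ 3 := fun t b => by ring
  simp only [hl, Finset.sum_add_distrib, Finset.sum_sub_distrib, ← Finset.mul_sum, C.sum_expSum,
    C.sum_expSum_sq, Finset.sum_const, Finset.card_univ, C.card_eq, nsmul_eq_mul, hq] at hsum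
  push_cast at hsum
  rw [hq, ← hP, ← hQ] at hsum
  have hP2 : P ^ 2 ≠ 0 := by positivity
  apply mul_left_cancel₀ hP2
  linear_combination hsum

theorem trp_eq_trace (C : OddMultiples p s l d F) (z : F) :
    trp p (2 * s) z = algebraMap (ZMod p) F (Algebra.trace (ZMod p) F z) := by
  have hfr : Module.finrank (ZMod p) F = 2 * s := by
    have h := Module.card_eq_pow_finrank (K := ZMod p) (V := F)
    rw [C.card_eq, ZMod.card] at h
    exact (Nat.pow_right_injective (Fact.out : p.Prime).two_le h).symm
  rw [FiniteField.algebraMap_trace_eq_sum_pow, hfr, Nat.card_zmod, trp]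

theorem trp_half (C : OddMultiples p s l d F) {z : F} (hz : z ^ p ^ s = z) :
    trp p s z = trp p (2 * s) (z / 2) := by
  have h := C.half_add_half_pow hz
  have h1 : trp p s z = trp p s (z / 2 + (z / 2) ^ p ^ s) := by rw [h]
  rw [h1]
  simp only [trp]
  rw [two_mul, Finset.sum_range_add, ← Finset.sum_add_distrib]
  refine Finset.sum_congr rfl fun i _ => ?_
  rw [add_pow_char_pow, pow_add, pow_mul]

theorem cword_eq (C : OddMultiples p s l d F) {a : F} (ha : a ^ p ^ s = a) (b c : F)
    (h : ZMod p) (x : F) :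
    cword p s l a b c h x = algebraMap (ZMod p) F (Algebra.trace (ZMod p) F
      (doPoly p s l (a / 2) b x) + Algebra.trace (ZMod p) F (c * x) + h) := by
  have hx := C.pow_card x
  rw [two_mul, pow_add, pow_mul] at hx
  have hz : (a * x ^ (p ^ s + 1)) ^ p ^ s = a * x ^ (p ^ s + 1) := by
    rw [mul_pow, ha, pow_succ, mul_pow, hx, mul_comm (x ^ p ^ s) x]
  have hh : (ZMod.cast h : F) = algebraMap (ZMod p) F h :=
    congrArg (fun f : ZMod p →+* F => f h)
      (Subsingleton.elim (ZMod.castHom (dvd_refl p) F) _)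
  rw [cword, C.trp_half hz, C.trp_eq_trace, C.trp_eq_trace, hh, ← map_add, ← map_add, ← map_add,
    ← map_add, doPoly]
  congr 3
  rw [← add_assoc]; congr 2; ring

/-- The number of zeros of the affine perturbation `Tr (doPoly x) + Tr (c x) + h`. -/
noncomputable def zeroCount (p s l : ℕ) [Fact p.Prime] {F : Type} [Field F] [Fintype F]
    [DecidableEq F] [Algebra (ZMod p) F] (t b c : F) (h : ZMod p) : ℕ :=
  (Finset.univ.filter fun x : F => Algebra.trace (ZMod p) F (doPoly p s l t b x)
    + Algebra.trace (ZMod p) F (c * x) + h = 0).card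

theorem card_suppw_add (C : OddMultiples p s l d F) {a : F} (ha : a ^ p ^ s = a) (b c : F)
    (h : ZMod p) :
    (suppw p s l a b c h).card + zeroCount p s l (a / 2) b c h = p ^ (2 * s) := by
  rw [← C.card_eq, ← Finset.card_univ, ← Finset.card_filter_add_card_filter_not
    (s := (Finset.univ : Finset F)) (fun x => cword p s l a b c h x ≠ 0), suppw, zeroCount]
  congr 2
  ext x
  simp only [Finset.mem_filter, Finset.mem_univ, true_and, not_not]
  rw [C.cword_eq ha, map_eq_zero]

theorem card_suppw_eq_iff (C : OddMultiples p s l d F) {a : F} (ha : a ^ p ^ s = a) (b c : F)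
    (h : ZMod p) :
    (suppw p s l a b c h).card = p ^ (s - 1) * (p - 1) * (p ^ s + 1) ↔
      (p : ℤ) * zeroCount p s l (a / 2) b c h = (p : ℤ) ^ (2 * s) - (p - 1) * p ^ s := by
  have hp : p.Prime := Fact.out
  have h1 := C.card_suppw_add ha b c h
  have h2 : p * p ^ (s - 1) = p ^ s := by
    rw [← pow_succ', Nat.sub_add_cancel (by have := C.d_lt; omega)]
  have h3 : (p : ℤ) * p ^ (s - 1) = p ^ s := by exact_mod_cast h2
  have h4 : ((p - 1 : ℕ) : ℤ) = p - 1 := by rw [Nat.cast_sub hp.one_le]; simp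
  have hp0 : (p : ℤ) ≠ 0 := by exact_mod_cast hp.ne_zero
  have hq : (p : ℤ) ^ (2 * s) = p ^ s * p ^ s := by rw [two_mul, pow_add]
  zify at h1 ⊢
  rw [h4]
  constructor
  · intro h5
    rw [h5] at h1
    rw [hq] at h1 ⊢
    linear_combination (p : ℤ) * h1 - ((p : ℤ) - 1) * (p ^ s + 1) * h3
  · intro h5
    apply mul_left_cancel₀ hp0
    rw [hq] at h1 h5
    linear_combination (p : ℤ) * h1 - h5 - ((p : ℤ) - 1) * (p ^ s + 1) * h3

theorem zeroCount_of_preimage (C : OddMultiples p s l d F) {t b c u : F} (h : ZMod p)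
    (hu : ∀ x, Algebra.trace (ZMod p) F (c * x)
      = Algebra.trace (ZMod p) F (x * doAdjoint p s l t b u)) :
    zeroCount p s l t b c h
      = fiberCount p s l t b (Algebra.trace (ZMod p) F (doPoly p s l t b u) - h) := by
  refine Finset.card_bij' (fun x _ => u + x) (fun x _ => x - u) ?_ ?_ ?_ ?_
  · intro x hx
    simp only [Finset.mem_filter, Finset.mem_univ, true_and] at hx ⊢
    rw [C.trace_doPoly_add, ← hu]
    linear_combination hx
  · intro x hx
    simp only [Finset.mem_filter, Finset.mem_univ, true_and] at hx ⊢
    obtain ⟨y, rfl⟩ : ∃ y, x = u + y := ⟨x - u, by ring⟩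
    rw [C.trace_doPoly_add, ← hu] at hx
    rw [add_sub_cancel_left]
    linear_combination hx
  · intro x _; ring
  · intro x _; ring

theorem zeroCount_of_radical (C : OddMultiples p s l d F) {t b c r : F} (h : ZMod p)
    (hr : doAdjoint p s l t b r = 0) (hc : Algebra.trace (ZMod p) F (c * r) ≠ 0) :
    (p : ℤ) * zeroCount p s l t b c h = (p : ℤ) ^ (2 * s) := by
  set f : F → ZMod p := fun x => Algebra.trace (ZMod p) F (doPoly p s l t b x)
    + Algebra.trace (ZMod p) F (c * x) + h with hf
  have hshift : ∀ (e : ZMod p) (x : F),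
      f (e • r + x) = f x + e * Algebra.trace (ZMod p) F (c * r) := by
    intro e x
    have h1 : doAdjoint p s l t b (e • r) = 0 := by
      rw [← C.doAdjointHom_apply, map_smul, C.doAdjointHom_apply, hr, smul_zero]
    simp only [hf]
    rw [C.trace_doPoly_add, h1, C.trace_doPoly_of_doAdjoint_eq_zero h1, mul_zero, map_zero,
      mul_add, map_add, mul_smul_comm, map_smul, smul_eq_mul]
    ring
  have hfib : ∀ v : ZMod p, (Finset.univ.filter fun x => f x = v).card
      = zeroCount p s l t b c h := by
    intro v
    set e := v / Algebra.trace (ZMod p) F (c * r) with he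
    have hev : e * Algebra.trace (ZMod p) F (c * r) = v := div_mul_cancel₀ _ hc
    symm
    refine Finset.card_bij' (fun x _ => e • r + x) (fun x _ => x - e • r) ?_ ?_ ?_ ?_
    · intro x hx
      simp only [Finset.mem_filter, Finset.mem_univ, true_and] at hx ⊢
      rw [hshift, hev, show f x = 0 from hx, zero_add]
    · intro x hx
      simp only [Finset.mem_filter, Finset.mem_univ, true_and] at hx ⊢
      obtain ⟨y, rfl⟩ : ∃ y, x = e • r + y := ⟨x - e • r, by ring⟩
      rw [hshift, hev] at hx
      rw [add_sub_cancel_left]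
      exact add_eq_right.1 hx
    · intro x _; ring
    · intro x _; ring
  have htot := Finset.card_eq_sum_card_fiberwise (s := (Finset.univ : Finset F))
    (t := (Finset.univ : Finset (ZMod p))) (f := f) (by intro x _; simp)
  rw [Finset.sum_congr rfl fun v _ => hfib v, Finset.sum_const, Finset.card_univ,
    Finset.card_univ, ZMod.card, C.card_eq, smul_eq_mul] at htot
  exact_mod_cast htot.symm

theorem expSum_eq_of_zeroCount (C : OddMultiples p s l d F) {t b c : F} {h : ZMod p}
    (hz : (p : ℤ) * zeroCount p s l t b c h = (p : ℤ) ^ (2 * s) - (p - 1) * p ^ s) :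
    expSum p s l t b = -(p : ℤ) ^ s := by
  have hp2 : (2 : ℤ) < p := by exact_mod_cast C.two_lt
  have hp1 : (p : ℤ) - 1 ≠ 0 := by omega
  have hP0 : (0 : ℤ) < (p : ℤ) ^ s := by positivity
  have hQ : (p : ℤ) ≤ (p : ℤ) ^ d := by exact_mod_cast Nat.le_self_pow C.d_pos.ne' p
  have hP : (p : ℤ) ≤ (p : ℤ) ^ s := by
    exact_mod_cast Nat.le_self_pow (by have := C.d_lt; omega) p
  rcases C.exists_adjoint_preimage_or t b c with ⟨u, hu⟩ | ⟨r, hr, hc⟩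
  · rw [C.zeroCount_of_preimage h hu] at hz
    by_cases hv : Algebra.trace (ZMod p) F (doPoly p s l t b u) - h = 0
    · rw [hv, C.mul_fiberCount_zero] at hz
      apply mul_left_cancel₀ hp1
      linear_combination hz
    · rw [C.mul_fiberCount_of_ne t b hv] at hz
      exfalso
      have hT : expSum p s l t b = (p - 1) * p ^ s := by linear_combination -hz
      by_cases h0 : t + t ^ p ^ s = 0 ∧ b = 0
      · rw [C.expSum_of_zero h0.1 h0.2, two_mul, pow_add] at hT
        have := mul_right_cancel₀ hP0.ne' hT
        omega
      · rcases C.expSum_cases h0 with h1 | h1 | h1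
        · rw [h1] at hT; nlinarith
        · rw [h1, mul_comm] at hT
          have := mul_right_cancel₀ hP0.ne' hT
          omega
        · rw [h1] at hT
          have : 0 ≤ (p : ℤ) ^ s * (p ^ d) ^ 2 := by positivity
          nlinarith
  · rw [C.zeroCount_of_radical h hr hc] at hz
    exfalso
    have : 0 < ((p : ℤ) - 1) * p ^ s := mul_pos (by omega) hP0
    linarith

theorem card_zeroCount_eq (C : OddMultiples p s l d F) {t b : F}
    (hT : expSum p s l t b = -(p : ℤ) ^ s) (c : F) :
    (Finset.univ.filter fun h : ZMod p => (p : ℤ) * zeroCount p s l t b c h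
      = (p : ℤ) ^ (2 * s) - (p - 1) * p ^ s).card = 1 := by
  have hp2 : (2 : ℤ) < p := by exact_mod_cast C.two_lt
  have hP0 : (0 : ℤ) < (p : ℤ) ^ s := by positivity
  have hker : ∀ r, doAdjoint p s l t b r = 0 → r = 0 := by
    have h1 := C.expSum_sq t b
    have h2 : (Finset.univ.filter fun x : F => doAdjoint p s l t b x = 0).card = 1 := by
      have h3 : (p : ℤ) ^ (2 * s) ≠ 0 := by positivity
      have h4 := mul_left_cancel₀ h3 (h1.symm.trans (show _ = (p : ℤ) ^ (2 * s) * 1 by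
        rw [hT]; ring))
      exact_mod_cast h4
    intro r hr
    have h0 : doAdjoint p s l t b 0 = 0 := (C.doAdjointHom t b).map_zero
    exact Finset.card_le_one.1 h2.le r (by simpa using hr) 0 (by simpa using h0)
  rcases C.exists_adjoint_preimage_or t b c with ⟨u, hu⟩ | ⟨r, hr, hc⟩
  · rw [Finset.card_eq_one]
    refine ⟨Algebra.trace (ZMod p) F (doPoly p s l t b u), ?_⟩
    ext h
    simp only [Finset.mem_filter, Finset.mem_univ, true_and, Finset.mem_singleton]
    rw [C.zeroCount_of_preimage h hu]
    constructor
    · intro hz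
      by_contra hne
      rw [C.mul_fiberCount_of_ne t b (sub_ne_zero.2 (Ne.symm hne)), hT] at hz
      nlinarith
    · rintro rfl
      rw [sub_self, C.mul_fiberCount_zero, hT]; ring
  · exact absurd (by rw [hker r hr, mul_zero, map_zero]) hc

theorem card_codewords_eq (C : OddMultiples p s l d F) :
    (Finset.univ.filter fun w : F × F × F × ZMod p => w.1 ^ p ^ s = w.1 ∧
      (suppw p s l w.1 w.2.1 w.2.2.1 w.2.2.2).card = p ^ (s - 1) * (p - 1) * (p ^ s + 1)).card
      * p ^ s
      = (Finset.univ.filter fun w : F × F => expSum p s l w.1 w.2 = -(p : ℤ) ^ s).card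
        * p ^ (2 * s) := by
  set R := Finset.univ.filter fun w : F × F =>
    w.1 ^ p ^ s = w.1 ∧ expSum p s l (w.1 / 2) w.2 = -(p : ℤ) ^ s with hR
  have h1 : (Finset.univ.filter fun w : F × F × F × ZMod p => w.1 ^ p ^ s = w.1 ∧
      (suppw p s l w.1 w.2.1 w.2.2.1 w.2.2.2).card = p ^ (s - 1) * (p - 1) * (p ^ s + 1)).card
      = R.card * p ^ (2 * s) := by
    have hmaps : Set.MapsTo (fun w : F × F × F × ZMod p => ((w.1, w.2.1), w.2.2.1))
        (Finset.univ.filter fun w : F × F × F × ZMod p => w.1 ^ p ^ s = w.1 ∧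
        (suppw p s l w.1 w.2.1 w.2.2.1 w.2.2.2).card
          = p ^ (s - 1) * (p - 1) * (p ^ s + 1) : Finset _) (R ×ˢ (Finset.univ : Finset F)) := by
      rintro ⟨a, b, c, h⟩ hw
      simp only [Finset.coe_filter, Finset.mem_univ, true_and, Set.mem_ofPred_eq, hR,
        Finset.coe_univ, Set.mem_prod, Set.mem_univ, and_true] at hw ⊢
      exact ⟨hw.1, C.expSum_eq_of_zeroCount ((C.card_suppw_eq_iff hw.1 b c h).1 hw.2)⟩
    rw [← Finset.coe_product] at hmaps
    rw [Finset.card_eq_sum_card_fiberwise hmaps, Finset.sum_congr rfl (g := fun _ => 1),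
      Finset.sum_const, Finset.card_product, Finset.card_univ, C.card_eq, smul_eq_mul, mul_one]
    rintro ⟨⟨a, b⟩, c⟩ hw
    simp only [Finset.mem_product, hR, Finset.mem_filter, Finset.mem_univ, true_and,
      and_true] at hw
    refine Eq.trans ?_ (C.card_zeroCount_eq hw.2 c)
    refine Finset.card_bij' (fun w _ => w.2.2.2) (fun h _ => (a, b, c, h)) ?_ ?_ ?_ ?_
    · rintro ⟨a', b', c', h⟩ hw'
      simp only [Finset.mem_filter, Finset.mem_univ, true_and, Prod.mk.injEq] at hw' ⊢
      obtain ⟨⟨h2, h3⟩, ⟨rfl, rfl⟩, rfl⟩ := hw'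
      exact (C.card_suppw_eq_iff h2 _ _ h).1 h3
    · intro h hh
      simp only [Finset.mem_filter, Finset.mem_univ, true_and] at hh ⊢
      exact ⟨⟨hw.1, (C.card_suppw_eq_iff hw.1 _ _ h).2 hh⟩, trivial⟩
    · rintro ⟨a', b', c', h⟩ hw'
      simp only [Finset.mem_filter, Finset.mem_univ, true_and, Prod.mk.injEq] at hw' ⊢
      obtain ⟨-, ⟨rfl, rfl⟩, rfl⟩ := hw'
      simp
    · intro h _; rfl
  have h2 : (Finset.univ.filter fun w : F × F => expSum p s l w.1 w.2 = -(p : ℤ) ^ s).card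
      = R.card * p ^ s := by
    have hmaps : Set.MapsTo (fun w : F × F => (w.1 + w.1 ^ p ^ s, w.2))
        (Finset.univ.filter fun w : F × F => expSum p s l w.1 w.2 = -(p : ℤ) ^ s : Finset _)
        R := by
      rintro ⟨t, b⟩ hw
      have ht := C.pow_card t
      rw [two_mul, pow_add, pow_mul] at ht
      have hfix : (t + t ^ p ^ s) ^ p ^ s = t + t ^ p ^ s := by
        rw [add_pow_char_pow, ht]; ring
      simp only [Finset.coe_filter, Finset.mem_univ, true_and, Set.mem_ofPred_eq, hR] at hw ⊢
      exact ⟨hfix, by rw [C.expSum_congr b (C.half_add_half_pow hfix), hw]⟩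
    rw [Finset.card_eq_sum_card_fiberwise hmaps, Finset.sum_congr rfl (g := fun _ => p ^ s),
      Finset.sum_const, smul_eq_mul]
    rintro ⟨a, b⟩ hw
    simp only [hR, Finset.mem_filter, Finset.mem_univ, true_and] at hw
    refine Eq.trans ?_ (C.card_add_pow_fiber hw.1)
    refine Finset.card_bij' (fun w _ => w.1) (fun t _ => (t, b)) ?_ ?_ ?_ ?_
    · rintro ⟨t, b'⟩ hw'
      simp only [Finset.mem_filter, Finset.mem_univ, true_and, Prod.mk.injEq] at hw' ⊢
      exact hw'.2.1
    · intro t ht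
      simp only [Finset.mem_filter, Finset.mem_univ, true_and] at ht ⊢
      refine ⟨?_, by rw [ht]⟩
      rw [C.expSum_congr b (ht.trans (C.half_add_half_pow hw.1).symm), hw.2]
    · rintro ⟨t, b'⟩ hw'
      simp only [Finset.mem_filter, Finset.mem_univ, true_and, Prod.mk.injEq] at hw' ⊢
      exact hw'.2.2.symm
    · intro t _; rfl
  rw [h1, h2]; ring

end OddMultiples

end HermitianForms

theorem stmt10 (p s l : ℕ) [Fact p.Prime] (F : Type) [Field F] [Fintype F] [DecidableEq F]
    [CharP F p] (hodd : Odd p) (hs : 2 ≤ s) (hl1 : 1 ≤ l) (hls : l ≠ s)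
    (hl2 : l ≤ 2 * s - 1) (hF : Fintype.card F = p ^ (2 * s)) (d : ℕ)
    (hd : Nat.gcd s l = d) (hd' : Nat.gcd (s + l) (2 * l) = 2 * d) :
    (((Finset.univ : Finset (F × F × F × ZMod p)).filter fun t =>
        t.1 ^ p ^ s = t.1 ∧ (suppw p s l t.1 t.2.1 t.2.2.1 t.2.2.2).card
          = p ^ (s - 1) * (p - 1) * (p ^ s + 1)).card : ℚ)
      = (p : ℚ) ^ (2 * s + 3 * d)
          * ((p : ℚ) ^ (2 * s) - (p : ℚ) ^ (2 * s - 2 * d) - (p : ℚ) ^ (2 * s - 3 * d)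
            + (p : ℚ) ^ s - (p : ℚ) ^ (s - d) + 1) * ((p : ℚ) ^ s - 1)
          / (((p : ℚ) ^ d + 1) * ((p : ℚ) ^ (2 * d) - 1)) := by
  let _ : Algebra (ZMod p) F := ZMod.algebra F p
  have C : OddMultiples p s l d F := .of_gcd hodd hs hl1 hls hl2 hF hd hd'
  have hp : p.Prime := Fact.out
  have hdpos := C.d_pos
  have hp0 : (0 : ℚ) < p := by exact_mod_cast hp.pos
  have h1 := C.card_codewords_eq
  have h2 := C.card_pairs_expSum_eq
  set N := ((Finset.univ : Finset (F × F × F × ZMod p)).filter fun t =>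
        t.1 ^ p ^ s = t.1 ∧ (suppw p s l t.1 t.2.1 t.2.2.1 t.2.2.2).card
          = p ^ (s - 1) * (p - 1) * (p ^ s + 1)).card
  set M := (Finset.univ.filter fun w : F × F => expSum p s l w.1 w.2 = -(p : ℤ) ^ s).card
  have h1' : (N : ℚ) * p ^ s = M * (p ^ s) ^ 2 := by
    rw [← pow_mul, mul_comm s 2]; exact_mod_cast h1
  have h2' : (M : ℚ) * (((p : ℚ) ^ d + 1) * ((p ^ d) ^ 2 - 1))
      = p ^ s * (p ^ s - 1) * ((p ^ s) ^ 2 * ((p ^ d) ^ 3 - p ^ d - 1)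
        + p ^ s * ((p ^ d) ^ 3 - (p ^ d) ^ 2) + (p ^ d) ^ 3) := by
    exact_mod_cast congrArg (Int.cast : ℤ → ℚ) h2
  have h3d : 3 * d ≤ s := by
    obtain ⟨i, hi⟩ := C.s_eq
    have := C.d_lt
    have hi1 : 1 ≤ i := Nat.one_le_iff_ne_zero.2 (by rintro rfl; omega)
    nlinarith
  obtain ⟨e, rfl⟩ := Nat.exists_eq_add_of_le h3d
  have e1 : 2 * (3 * d + e) - 2 * d = 4 * d + 2 * e := by omega
  have e2 : 2 * (3 * d + e) - 3 * d = 3 * d + 2 * e := by omega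
  have e3 : 3 * d + e - d = 2 * d + e := by omega
  have hQ1 : (1 : ℚ) < (p : ℚ) ^ d := one_lt_pow₀ (by exact_mod_cast hp.one_lt) hdpos.ne'
  have hden : ((p : ℚ) ^ d + 1) * ((p : ℚ) ^ (2 * d) - 1) ≠ 0 := by
    rw [mul_comm 2 d, pow_mul]
    refine mul_ne_zero (by positivity) ?_
    nlinarith
  rw [eq_div_iff hden, e1, e2, e3]
  have hP : (p : ℚ) ^ (3 * d + e) = ((p : ℚ) ^ d) ^ 3 * p ^ e := by ring
  have hP0 : (p : ℚ) ^ (3 * d + e) ≠ 0 := by positivity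
  apply mul_left_cancel₀ hP0
  generalize (N : ℚ) = n at *
  generalize (M : ℚ) = k at *
  have hx : ∀ i j : ℕ, (p : ℚ) ^ (i * d + j * e) = ((p : ℚ) ^ d) ^ i * (p ^ e) ^ j := by
    intro i j; ring
  have f1 := hx 2 0
  have f2 := hx 9 2
  have f3 := hx 6 2
  have f4 := hx 4 2
  have f5 := hx 3 2
  have f6 := hx 2 1
  rw [show 2 * d + 0 * e = 2 * d by ring] at f1
  rw [show 9 * d + 2 * e = 2 * (3 * d + e) + 3 * d by ring] at f2
  rw [show 6 * d + 2 * e = 2 * (3 * d + e) by ring] at f3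
  rw [one_mul] at f6
  rw [hP] at h1' h2' ⊢
  rw [f1, f2, f3, f4, f5, f6]
  linear_combination (((p : ℚ) ^ d + 1) * ((p ^ d) ^ 2 - 1)) * h1'
    + (((p : ℚ) ^ d) ^ 3 * p ^ e) ^ 2 * h2'
end

section
/- Assume gcd(s+l,2l) = 2·gcd(s,l), and write d = gcd(s,l). Then the number of quadruples (a,b,c,h) ∈ F_{p^s} × F_q × F_q × F_p for which the codeword c(a,b,c,h) has Hamming weight p^{s+d−1}(p−1)(p^{s−d} − 1) equals p^{m−d}(p^s + p^{s−d} + p^{s−2d} + 1)(p^m − 1)/(p^d + 1)^2. -/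
section

open Finset

section QuadraticForm

variable {p : ℕ} [Fact p.Prime] {F : Type} [Field F] [Fintype F] [DecidableEq F]
  [Algebra (ZMod p) F]

/-- The number of solutions of `q x = v`. -/
def levelCard (q : F → ZMod p) (v : ZMod p) : ℕ :=
  #{x : F | q x = v}

/-- The exponential sum of a quadratic form all of whose nonzero values are attained equally
often, written as an integer. -/
def levelDiff (q : F → ZMod p) : ℤ :=
  (levelCard q 0 : ℤ) - levelCard q 1

omit [DecidableEq F] [Algebra (ZMod p) F] in
lemma levelCard_eq_one {q : F → ZMod p}
    (hq : ∀ v : ZMod p, v ≠ 0 → ∃ t : F, t ≠ 0 ∧ ∀ x, q (t * x) = v * q x)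
    {v : ZMod p} (hv : v ≠ 0) : levelCard q v = levelCard q 1 := by
  obtain ⟨t, ht, h⟩ := hq v hv
  symm
  refine card_bij (fun x _ => t * x) ?_ ?_ ?_
  · intro x hx
    simp only [mem_filter, mem_univ, true_and] at hx ⊢
    rw [h, hx, mul_one]
  · intro x _ y _ hxy
    exact mul_left_cancel₀ ht hxy
  · intro y hy
    simp only [mem_filter, mem_univ, true_and] at hy
    refine ⟨t⁻¹ * y, ?_, by field_simp⟩
    simp only [mem_filter, mem_univ, true_and]
    have := h (t⁻¹ * y)
    rw [mul_inv_cancel_left₀ ht, hy] at this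
    exact (mul_left_cancel₀ hv (by rw [mul_one]; exact this)).symm

omit [Field F] [DecidableEq F] [Algebra (ZMod p) F] in
lemma sum_comp_eq_sum_levelCard {R : Type*} [CommRing R] (q : F → ZMod p) (f : ZMod p → R) :
    ∑ x, f (q x) = ∑ v, levelCard q v * f v := by
  rw [← sum_fiberwise (s := univ) (g := q)]
  refine sum_congr rfl fun v _ => ?_
  rw [sum_congr rfl (g := fun _ => f v), sum_const, nsmul_eq_mul, levelCard]
  intro x hx
  rw [(mem_filter.1 hx).2]

omit [DecidableEq F] [Algebra (ZMod p) F] in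
lemma levelCard_add {q : F → ZMod p}
    (hq : ∀ v : ZMod p, v ≠ 0 → ∃ t : F, t ≠ 0 ∧ ∀ x, q (t * x) = v * q x) :
    (levelCard q 0 : ℤ) + (p - 1) * levelCard q 1 = Fintype.card F := by
  have h := sum_comp_eq_sum_levelCard (R := ℤ) q (fun _ => 1)
  rw [← add_sum_erase (univ : Finset (ZMod p)) _ (mem_univ 0),
    sum_congr (s₁ := univ.erase 0) rfl (g := fun _ => (levelCard q 1 : ℤ))] at h
  · have hp : 1 ≤ p := (Fact.out : p.Prime).one_le
    simp only [sum_const, card_univ, nsmul_eq_mul, mul_one, card_erase_of_mem (mem_univ _),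
      ZMod.card] at h
    rw [h]; push_cast [hp]; ring
  · intro v hv
    rw [levelCard_eq_one hq (ne_of_mem_erase hv), mul_one]

omit [DecidableEq F] [Algebra (ZMod p) F] in
lemma sum_addChar_eq_levelDiff {q : F → ZMod p}
    (hq : ∀ v : ZMod p, v ≠ 0 → ∃ t : F, t ≠ 0 ∧ ∀ x, q (t * x) = v * q x)
    {ψ : AddChar (ZMod p) ℂ} (hψ : ψ ≠ 0) :
    ∑ x, ψ (q x) = levelDiff q := by
  rw [sum_comp_eq_sum_levelCard, ← add_sum_erase (univ : Finset (ZMod p)) _ (mem_univ 0),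
    sum_congr rfl (g := fun v => (levelCard q 1 : ℂ) * ψ v), ← mul_sum]
  · have h : ∑ v, ψ v = 0 := by
      classical
      rw [AddChar.sum_eq_ite, if_neg hψ]
    rw [← add_sum_erase (univ : Finset (ZMod p)) _ (mem_univ 0), AddChar.map_zero_eq_one] at h
    rw [levelDiff, eq_neg_of_add_eq_zero_right h, AddChar.map_zero_eq_one]
    push_cast; ring
  · intro v hv
    rw [levelCard_eq_one hq (ne_of_mem_erase hv)]

lemma sum_addChar_mul {T : F →ₗ[ZMod p] ZMod p} (hT : ∀ a, (∀ x, T (a * x) = 0) → a = 0)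
    {ψ : AddChar (ZMod p) ℂ} (hψ : ψ.IsPrimitive) (a : F) :
    ∑ x, ψ (T (a * x)) = if a = 0 then (Fintype.card F : ℂ) else 0 := by
  classical
  have h := AddChar.sum_eq_ite
    (ψ.compAddMonoidHom (T.toAddMonoidHom.comp (AddMonoidHom.mulLeft a)))
  refine h.trans (if_congr ⟨fun h => hT a fun x => ?_, ?_⟩ rfl rfl)
  · by_contra hx
    refine hψ hx ?_
    ext z
    have := DFunLike.congr_fun h (algebraMap (ZMod p) F z * x)
    simpa [AddChar.mulShift_apply, mul_left_comm a, ← Algebra.smul_def, mul_comm z] using this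
  · rintro rfl
    ext z
    simp

variable {T : F →ₗ[ZMod p] ZMod p} {q : F → ZMod p} {L : F →ₗ[ZMod p] F}

omit [Fintype F] [DecidableEq F] in
lemma polar_symm (hqL : ∀ x y, q (x + y) = q x + q y + T (L x * y)) (x y : F) :
    T (L x * y) = T (L y * x) := by
  have h1 := hqL x y
  have h2 := hqL y x
  rw [add_comm y x, h1] at h2
  linear_combination h2

omit [Fintype F] [DecidableEq F] in
lemma eq_zero_of_mem_ker (hp : p ≠ 2) (hqL : ∀ x y, q (x + y) = q x + q y + T (L x * y))
    (hneg : ∀ x, q (-x) = q x) {y : F} (hy : y ∈ LinearMap.ker L) : q y = 0 := by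
  have h0 := hqL 0 0
  have h1 := hqL y (-y)
  rw [LinearMap.mem_ker] at hy
  simp only [hy, hneg, add_neg_cancel, map_zero, zero_mul, add_zero] at h0 h1
  have h2 : (2 : ZMod p) ≠ 0 := by
    intro h
    have : ((2 : ℕ) : ZMod p) = 0 := by exact_mod_cast h
    rw [ZMod.natCast_eq_zero_iff] at this
    exact hp ((Nat.prime_dvd_prime_iff_eq Fact.out Nat.prime_two).1 this)
  have h3 : 2 * q y = 0 := by linear_combination -h1 - h0
  exact (mul_eq_zero.1 h3).resolve_left h2

lemma levelDiff_sq (hp : p ≠ 2) (hT : ∀ a, (∀ x, T (a * x) = 0) → a = 0)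
    (hqL : ∀ x y, q (x + y) = q x + q y + T (L x * y)) (hneg : ∀ x, q (-x) = q x)
    (hq : ∀ v : ZMod p, v ≠ 0 → ∃ t : F, t ≠ 0 ∧ ∀ x, q (t * x) = v * q x) :
    levelDiff q ^ 2 = Fintype.card F * Nat.card (LinearMap.ker L) := by
  have hψ := ZMod.isPrimitive_stdAddChar p
  set ψ : AddChar (ZMod p) ℂ := ZMod.stdAddChar
  have hψ0 : ψ ≠ 0 := by
    rintro h
    exact hψ one_ne_zero (by ext; simp [h])
  have hψ1 : ψ⁻¹ ≠ 0 := by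
    intro h; exact hψ0 (by rw [← inv_inv ψ, h]; rfl)
  have key : (levelDiff q : ℂ) ^ 2 = Fintype.card F * Nat.card (LinearMap.ker L) := by
    calc (levelDiff q : ℂ) ^ 2 = (∑ x, ψ (q x)) * ∑ y, ψ⁻¹ (q y) := by
          rw [sum_addChar_eq_levelDiff hq hψ0, sum_addChar_eq_levelDiff hq hψ1, sq]
      _ = ∑ y, ∑ x, ψ (q x) * ψ⁻¹ (q y) := by rw [sum_mul_sum, sum_comm]
      _ = ∑ y, ∑ x, ψ (q x) * ψ (T (L x * y)) := by
          refine sum_congr rfl fun y _ => ?_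
          rw [← Equiv.sum_comp (Equiv.addRight y)]
          refine sum_congr rfl fun x _ => ?_
          rw [Equiv.coe_addRight, AddChar.inv_apply, ← AddChar.map_add_eq_mul,
            ← AddChar.map_add_eq_mul, hqL]
          congr 1; ring
      _ = ∑ x, ψ (q x) * ∑ y, ψ (T (L x * y)) := by
          rw [sum_comm]; simp_rw [mul_sum]
      _ = ∑ x, if L x = 0 then (Fintype.card F : ℂ) else 0 := by
          refine sum_congr rfl fun x _ => ?_
          rw [sum_addChar_mul hT hψ]
          split_ifs with h
          · rw [eq_zero_of_mem_ker hp hqL hneg (LinearMap.mem_ker.2 h),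
              AddChar.map_zero_eq_one, one_mul]
          · rw [mul_zero]
      _ = _ := by
          rw [← sum_filter, sum_const, nsmul_eq_mul, mul_comm]
          congr 2
          exact (Nat.subtype_card _ (by simp)).symm
  exact_mod_cast key

omit [DecidableEq F] in
lemma card_affine_of_mem_range
    (hqL : ∀ x y, q (x + y) = q x + q y + T (L x * y)) (x₀ : F) (h : ZMod p) :
    #{x : F | q x + T (L x₀ * x) + h = 0} = levelCard q (q x₀ - h) := by
  refine card_bij (fun x _ => x₀ + x) ?_ ?_ ?_
  · intro x hx
    simp only [mem_filter, mem_univ, true_and] at hx ⊢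
    rw [hqL]; linear_combination hx
  · intro x _ y _ hxy
    exact add_left_cancel hxy
  · intro y hy
    simp only [mem_filter, mem_univ, true_and] at hy
    refine ⟨y - x₀, ?_, by ring⟩
    have := hqL x₀ (y - x₀)
    rw [add_sub_cancel, hy] at this
    simp only [mem_filter, mem_univ, true_and]
    linear_combination -this

omit [DecidableEq F] in
lemma card_affine_of_notMem_range (hp : p ≠ 2) (hT : ∀ a, (∀ x, T (a * x) = 0) → a = 0)
    (hqL : ∀ x y, q (x + y) = q x + q y + T (L x * y)) (hneg : ∀ x, q (-x) = q x)
    {c : F} (hc : c ∉ LinearMap.range L) (h : ZMod p) :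
    p * #{x : F | q x + T (c * x) + h = 0} = Fintype.card F := by
  obtain ⟨y, hy, hcy⟩ : ∃ y ∈ LinearMap.ker L, T (c * y) ≠ 0 := by
    obtain ⟨f, hfc, hf⟩ := Submodule.exists_le_ker_of_notMem hc
    let D : F →ₗ[ZMod p] Module.Dual (ZMod p) F := (LinearMap.mul (ZMod p) F).compr₂ T
    have hD : Function.Injective D := by
      rw [injective_iff_map_eq_zero]
      intro a ha
      exact hT a fun x => by simpa [D] using DFunLike.congr_fun ha x
    have hDs : Function.Surjective D := by
      refine (LinearMap.injective_iff_surjective_of_finrank_eq_finrank ?_).1 hD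
      exact (Subspace.dual_finrank_eq).symm
    obtain ⟨y, rfl⟩ := hDs f
    refine ⟨y, LinearMap.mem_ker.2 (hT _ fun x => ?_), by simpa [D, mul_comm] using hfc⟩
    rw [polar_symm hqL]
    have := hf (LinearMap.mem_range_self L x)
    simpa [D, mul_comm] using this
  have hshift : ∀ v : ZMod p, #{x : F | q x + T (c * x) + h = v}
      = #{x : F | q x + T (c * x) + h = 0} := by
    intro v
    have hk : ∃ k : ZMod p, k * T (c * y) = v := ⟨v / T (c * y), div_mul_cancel₀ _ hcy⟩
    obtain ⟨k, hk⟩ := hk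
    have hky : k • y ∈ LinearMap.ker L := Submodule.smul_mem _ _ hy
    have e : ∀ x, q (k • y + x) + T (c * (k • y + x)) + h = q x + T (c * x) + h + v := by
      intro x
      rw [hqL, LinearMap.mem_ker.1 hky, zero_mul, map_zero,
        eq_zero_of_mem_ker hp hqL hneg hky, mul_add, map_add, mul_smul_comm, map_smul,
        smul_eq_mul, hk]
      ring
    symm
    refine card_bij (fun x _ => k • y + x) ?_ ?_ ?_
    · intro x hx
      simp only [mem_filter, mem_univ, true_and] at hx ⊢
      rw [e, hx, zero_add]
    · intro x _ z _ hxz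
      exact add_left_cancel hxz
    · intro z hz
      refine ⟨z - k • y, ?_, by simp⟩
      simp only [mem_filter, mem_univ, true_and] at hz ⊢
      have := e (z - k • y)
      rw [add_sub_cancel, hz] at this
      linear_combination -this
  have := card_eq_sum_card_fiberwise (s := (univ : Finset F)) (t := univ)
    (f := fun x => q x + T (c * x) + h) (by simp)
  rw [sum_congr rfl (fun v _ => hshift v), sum_const, card_univ, card_univ, ZMod.card,
    smul_eq_mul] at this
  exact this.symm

/-- Number of affine shifts of a quadratic form with a prescribed number `M` of zeros, when `M`
is neither the generic count nor the size of a nonzero level set. -/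
lemma card_affine_shifts (hp : p ≠ 2) (hT : ∀ a, (∀ x, T (a * x) = 0) → a = 0)
    (hqL : ∀ x y, q (x + y) = q x + q y + T (L x * y)) (hneg : ∀ x, q (-x) = q x)
    (hq : ∀ v : ZMod p, v ≠ 0 → ∃ t : F, t ≠ 0 ∧ ∀ x, q (t * x) = v * q x)
    {M : ℕ} (hM : p * M ≠ Fintype.card F) (hM1 : levelCard q 1 ≠ M) :
    #{u : F × ZMod p | #{x : F | q x + T (u.1 * x) + u.2 = 0} = M} * Nat.card (LinearMap.ker L)
      = if levelCard q 0 = M then Fintype.card F else 0 := by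
  have main : ∀ c h, #{x : F | q x + T (c * x) + h = 0} = M ↔
      levelCard q 0 = M ∧ ∃ x₀, L x₀ = c ∧ h = q x₀ := by
    intro c h
    constructor
    · intro hc
      by_cases hcr : c ∈ LinearMap.range L
      · obtain ⟨x₀, rfl⟩ := hcr
        rw [card_affine_of_mem_range hqL] at hc
        by_cases h0 : q x₀ - h = 0
        · exact ⟨h0 ▸ hc, x₀, rfl, (sub_eq_zero.1 h0).symm⟩
        · rw [levelCard_eq_one hq h0] at hc
          exact absurd hc hM1
      · have := card_affine_of_notMem_range hp hT hqL hneg hcr h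
        rw [hc] at this
        exact absurd this hM
    · rintro ⟨h0, x₀, rfl, rfl⟩
      rw [card_affine_of_mem_range hqL, sub_self, h0]
  split_ifs with h0
  · have hcard : #{u : F × ZMod p | #{x : F | q x + T (u.1 * x) + u.2 = 0} = M}
        = Nat.card (LinearMap.range L) := by
      classical
      rw [Nat.card_eq_fintype_card, Fintype.card_subtype]
      refine card_bij (fun u _ => u.1) ?_ ?_ ?_
      · intro u hu
        simp only [mem_filter, mem_univ, true_and, main] at hu ⊢
        obtain ⟨-, x, hx, -⟩ := hu
        exact ⟨x, hx⟩
      · rintro ⟨c, h⟩ hu ⟨c', h'⟩ hu' (rfl : c = c')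
        simp only [mem_filter, mem_univ, true_and, main] at hu hu'
        obtain ⟨-, x, hx, rfl⟩ := hu
        obtain ⟨-, y, hy, rfl⟩ := hu'
        have hk : y - x ∈ LinearMap.ker L := by
          rw [LinearMap.mem_ker, map_sub, hx, hy, sub_self]
        have := hqL (y - x) x
        rw [sub_add_cancel, LinearMap.mem_ker.1 hk, eq_zero_of_mem_ker hp hqL hneg hk, zero_mul,
          map_zero, zero_add, add_zero] at this
        rw [this]
      · intro c hc
        simp only [mem_filter, mem_univ, true_and] at hc
        obtain ⟨x, rfl⟩ := hc
        exact ⟨(L x, q x), by simpa [main] using ⟨h0, x, rfl, rfl⟩, rfl⟩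
    rw [hcard, ← Nat.card_congr L.quotKerEquivRange.toEquiv, mul_comm,
      ← Submodule.card_eq_card_quotient_mul_card, Nat.card_eq_fintype_card]
  · rw [filter_false_of_mem, card_empty, zero_mul]
    intro u _ hu
    exact h0 ((main _ _).1 hu).1

end QuadraticForm

section FiniteField

lemma exists_odd_mul_of_gcd {s l d : ℕ} (hs : 0 < s) (hd : Nat.gcd s l = d)
    (hd' : Nat.gcd (s + l) (2 * l) = 2 * d) :
    0 < d ∧ ∃ i j, s = d * (2 * i + 1) ∧ l = d * (2 * j + 1) := by
  have hd0 : 0 < d := hd ▸ Nat.gcd_pos_of_pos_left _ hs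
  obtain ⟨s', l', hc, hs', hl'⟩ : ∃ s' l', Nat.Coprime s' l' ∧ s = d * s' ∧ l = d * l' := by
    obtain ⟨s', l', hc, h1, h2⟩ := Nat.exists_coprime s l
    exact ⟨s', l', hc, by rw [← hd, mul_comm]; exact h1, by rw [← hd, mul_comm]; exact h2⟩
  have h2 : 2 ∣ s' + l' := by
    have : 2 * d ∣ s + l := hd' ▸ Nat.gcd_dvd_left _ _
    rw [hs', hl', ← mul_add, mul_comm 2 d] at this
    exact Nat.dvd_of_mul_dvd_mul_left hd0 this
  have hnot : ¬ (2 ∣ s' ∧ 2 ∣ l') := by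
    rintro ⟨h, h'⟩
    have := Nat.dvd_gcd h h'
    rw [hc] at this
    omega
  exact ⟨hd0, s' / 2, l' / 2, by rw [hs']; congr 1; omega, by rw [hl']; congr 1; omega⟩

variable {p : ℕ} {F : Type} [Field F]

lemma pow_prime_pow_gcd [Fact p.Prime] [CharP F p] {x : F} {i j : ℕ}
    (hi : x ^ p ^ i = x) (hj : x ^ p ^ j = x) : x ^ p ^ Nat.gcd i j = x := by
  simp only [← iterate_frobenius] at *
  exact Function.IsPeriodicPt.gcd hi hj

lemma pow_prime_pow_add_mul {x : F} {e : ℕ} (h : x ^ p ^ e = x) (r k : ℕ) :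
    x ^ p ^ (r + e * k) = x ^ p ^ r := by
  induction k with
  | zero => simp
  | succ k ih => rw [mul_add, mul_one, ← add_assoc, pow_add, pow_mul, ih, ← pow_mul, mul_comm,
      pow_mul, h]

variable [Fintype F] [DecidableEq F]

lemma card_pow_eq_one {k : ℕ} (hk : 0 < k) (h : k ∣ Fintype.card F - 1) :
    #{t : F | t ^ k = 1} = k := by
  have h1 := IsCyclic.card_powMonoidHom_ker Fˣ k
  rw [Nat.card_eq_fintype_card, Nat.card_eq_fintype_card, Fintype.card_units,
    Nat.gcd_eq_right h, Fintype.card_subtype] at h1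
  refine Eq.trans ?_ h1
  symm
  refine card_bij (fun u _ => (u : F)) ?_ ?_ ?_
  · intro u hu
    simp only [mem_filter, mem_univ, true_and, MonoidHom.mem_ker, powMonoidHom_apply] at hu ⊢
    simpa using congrArg Units.val hu
  · intro u _ v _ huv
    exact Units.ext huv
  · intro t ht
    simp only [mem_filter, mem_univ, true_and] at ht
    have ht0 : t ≠ 0 := by
      rintro rfl
      rw [zero_pow hk.ne'] at ht
      exact zero_ne_one ht
    refine ⟨Units.mk0 t ht0, ?_, rfl⟩
    simp only [mem_filter, mem_univ, true_and, MonoidHom.mem_ker, powMonoidHom_apply]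
    exact Units.ext (by simpa using ht)

lemma card_pow_eq_self {n : ℕ} (hn : 1 < n) (h : n - 1 ∣ Fintype.card F - 1) :
    #{t : F | t ^ n = t} = n := by
  have : ({t : F | t ^ n = t} : Finset F) = insert 0 ({t : F | t ^ (n - 1) = 1} : Finset F) := by
    ext t
    simp only [mem_filter, mem_univ, true_and, mem_insert]
    by_cases ht : t = 0
    · simp [ht, (zero_lt_one.trans hn).ne']
    · obtain ⟨m, rfl⟩ : ∃ m, n = m + 1 := ⟨n - 1, by omega⟩
      simp [ht, pow_succ]
  rw [this, card_insert_of_notMem, card_pow_eq_one (by omega) h]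
  · omega
  · simp [show n - 1 ≠ 0 by omega]

omit [DecidableEq F] in
lemma exists_pow_eq_of_pow_eq_one_s11 {k e : ℕ} (h : k * e = Fintype.card F - 1) {v : F}
    (hv : v ^ e = 1) : ∃ t, t ^ k = v := by
  classical
  have hq : 0 < Fintype.card F - 1 := by
    have := Fintype.one_lt_card (α := F); omega
  have hk : 0 < k := Nat.pos_of_ne_zero (by rintro rfl; omega)
  have he : 0 < e := Nat.pos_of_ne_zero (by rintro rfl; omega)
  have hc : Nat.card Fˣ = k * e := by
    rw [Nat.card_eq_fintype_card, Fintype.card_units, h]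
  have hle : (powMonoidHom k : Fˣ →* Fˣ).range ≤ (powMonoidHom e : Fˣ →* Fˣ).ker := by
    rintro _ ⟨u, rfl⟩
    rw [MonoidHom.mem_ker, powMonoidHom_apply, powMonoidHom_apply, ← pow_mul, ← hc,
      pow_card_eq_one']
  have heq := Subgroup.eq_of_le_of_card_ge hle (by
    rw [IsCyclic.card_powMonoidHom_ker, IsCyclic.card_powMonoidHom_range, hc,
      Nat.gcd_eq_right (dvd_mul_left _ _), Nat.gcd_eq_right (dvd_mul_right _ _),
      Nat.mul_div_cancel_left _ hk])
  have hv0 : v ≠ 0 := by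
    rintro rfl
    rw [zero_pow he.ne'] at hv
    exact zero_ne_one hv
  have : Units.mk0 v hv0 ∈ (powMonoidHom e : Fˣ →* Fˣ).ker := by
    rw [MonoidHom.mem_ker, powMonoidHom_apply]
    exact Units.ext (by simpa using hv)
  rw [← heq] at this
  obtain ⟨u, hu⟩ := this
  exact ⟨u, by simpa using congrArg Units.val hu⟩

/-- A set of nonzero elements stable under the `k`-th roots of unity has size divisible by `k`. -/
lemma dvd_card_of_stable {k : ℕ} (hk : 0 < k) (h : k ∣ Fintype.card F - 1) {X : Finset F}
    (h0 : (0 : F) ∉ X) (hX : ∀ t x : F, t ^ k = 1 → x ∈ X → t * x ∈ X) : k ∣ #X := by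
  rw [card_eq_sum_card_fiberwise (t := univ) (f := fun x : F => x ^ k) (by simp)]
  refine dvd_sum fun y _ => ?_
  rcases ({x ∈ X | x ^ k = y} : Finset F).eq_empty_or_nonempty with he | ⟨x, hx⟩
  · rw [he]; simp
  · rw [mem_filter] at hx
    have hx0 : x ≠ 0 := fun h => h0 (h ▸ hx.1)
    have : #{t : F | t ^ k = 1} = #{x ∈ X | x ^ k = y} := by
      refine card_bij (fun t _ => t * x) ?_ ?_ ?_
      · intro t ht
        simp only [mem_filter, mem_univ, true_and] at ht ⊢
        exact ⟨hX t x ht hx.1, by rw [mul_pow, ht, one_mul, hx.2]⟩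
      · intro t _ u _ htu
        exact mul_right_cancel₀ hx0 htu
      · intro z hz
        rw [mem_filter] at hz
        refine ⟨z / x, ?_, div_mul_cancel₀ _ hx0⟩
        simp only [mem_filter, mem_univ, true_and]
        rw [div_pow, hz.2, hx.2, div_self]
        rw [← hx.2]; exact pow_ne_zero _ hx0
    rw [← this, card_pow_eq_one hk h]

lemma dvd_levelDiff_sub_one [Fact p.Prime] {k : ℕ} (hk : 0 < k) (h : k ∣ Fintype.card F - 1)
    {q : F → ZMod p} (h0 : q 0 = 0) (hq : ∀ t x : F, t ^ k = 1 → q (t * x) = q x) :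
    (k : ℤ) ∣ levelDiff q - 1 := by
  have e0 : k ∣ #(({x : F | q x = 0} : Finset F).erase 0) := by
    refine dvd_card_of_stable hk h (by simp) fun t x ht hx => ?_
    have ht0 : t ≠ 0 := by
      rintro rfl
      rw [zero_pow hk.ne'] at ht
      exact zero_ne_one ht
    simpa [ht0, hq t x ht] using hx
  have e1 : k ∣ #({x : F | q x = 1} : Finset F) := by
    refine dvd_card_of_stable hk h (by simp [h0]) fun t x ht hx => ?_
    simpa [hq t x ht] using hx
  have hc : #(({x : F | q x = 0} : Finset F).erase 0) + 1 = levelCard q 0 :=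
    card_erase_add_one (by simp [h0])
  have : levelDiff q - 1 = (#(({x : F | q x = 0} : Finset F).erase 0) : ℤ)
      - #({x : F | q x = 1} : Finset F) := by
    rw [levelDiff, ← hc, levelCard]; push_cast; ring
  rw [this]
  exact dvd_sub (Int.natCast_dvd_natCast.2 e0) (Int.natCast_dvd_natCast.2 e1)

lemma eq_of_sq_eq_of_dvd_sub_one {p s d i j : ℕ} (hp : p.Prime) (hodd : Odd p) (hd : 0 < d)
    (hs : s = d * (2 * i + 1)) {S : ℤ} (hS : S ^ 2 = (p : ℤ) ^ (2 * s) * p ^ j)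
    (hj : j ≤ 4 * d) (h1 : ((p : ℤ) ^ d + 1) ∣ S - 1) :
    (S = -(p : ℤ) ^ s ∧ j = 0) ∨ (S = (p : ℤ) ^ (s + d) ∧ j = 2 * d)
      ∨ (S = -(p : ℤ) ^ (s + 2 * d) ∧ j = 4 * d) := by
  have hp2 : 2 < p := by
    have := hp.two_le
    rcases hodd with ⟨k, hk⟩
    omega
  have hpZ : (2 : ℤ) < p := by exact_mod_cast hp2
  obtain ⟨e, he⟩ : ∃ e, S.natAbs = p ^ e := by
    have : S.natAbs ∣ p ^ (2 * s + j) := by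
      refine Dvd.intro S.natAbs ?_
      have h2 : ((S.natAbs * S.natAbs : ℕ) : ℤ) = ((p ^ (2 * s + j) : ℕ) : ℤ) := by
        push_cast
        rw [← sq, sq_abs, hS, pow_add]
      exact_mod_cast h2
    obtain ⟨e, -, he⟩ := (Nat.dvd_prime_pow hp).1 this
    exact ⟨e, he⟩
  have hej : 2 * e = 2 * s + j := by
    have : ((p ^ (2 * e) : ℕ) : ℤ) = ((p ^ (2 * s + j) : ℕ) : ℤ) := by
      rw [mul_comm 2 e, pow_mul, ← he]
      push_cast
      rw [sq_abs, hS, pow_add]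
    exact Nat.pow_right_injective hp.two_le (by exact_mod_cast this)
  set Q : ℤ := (p : ℤ) ^ d with hQ
  have hQ2 : 2 < Q := by
    calc (2 : ℤ) < p := hpZ
      _ ≤ p ^ d := le_self_pow₀ (by omega) hd.ne'
  set f := e / d
  set r := e % d
  have hr : r < d := Nat.mod_lt _ hd
  have hfr : e = d * f + r := (Nat.div_add_mod e d).symm
  obtain ⟨u, hu, hSu⟩ : ∃ u : ℤ, (u = 1 ∨ u = -1) ∧ S = u * (Q ^ f * p ^ r) := by
    have : Q ^ f * p ^ r = (S.natAbs : ℤ) := by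
      rw [he, hfr, pow_add, pow_mul]; push_cast; rfl
    rw [this]
    rcases Int.natAbs_eq S with h | h
    · exact ⟨1, Or.inl rfl, by rw [one_mul]; exact h⟩
    · exact ⟨-1, Or.inr rfl, by rw [neg_one_mul]; exact h⟩
  obtain ⟨w, hw, hdw⟩ : ∃ w : ℤ, (w = 1 ∧ Even f ∨ w = -1 ∧ Odd f) ∧ (Q + 1) ∣ Q ^ f - w := by
    have hd1 : (Q + 1) ∣ Q ^ f - (-1) ^ f := by
      have := sub_dvd_pow_sub_pow Q (-1) f
      rwa [sub_neg_eq_add] at this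
    rcases Nat.even_or_odd f with hf | hf
    · exact ⟨1, Or.inl ⟨rfl, hf⟩, by rwa [hf.neg_one_pow] at hd1⟩
    · exact ⟨-1, Or.inr ⟨rfl, hf⟩, by rwa [hf.neg_one_pow] at hd1⟩
  have hdr : (Q + 1) ∣ u * w * p ^ r - 1 := by
    have : u * w * p ^ r - 1 = (S - 1) - (Q ^ f - w) * (u * p ^ r) := by rw [hSu]; ring
    rw [this]
    exact dvd_sub h1 (hdw.mul_right _)
  have hpr1 : (1 : ℤ) ≤ p ^ r := one_le_pow₀ (by omega)
  have hprQ : (p : ℤ) ^ r < Q := pow_lt_pow_right₀ (by omega) hr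
  have huw : u * w = 1 ∧ (p : ℤ) ^ r = 1 := by
    have hcase : u * w = 1 ∨ u * w = -1 := by
      rcases hu with rfl | rfl <;> rcases hw with ⟨rfl, -⟩ | ⟨rfl, -⟩ <;> simp
    have hz : u * w * p ^ r - 1 = 0 := by
      refine Int.eq_zero_of_abs_lt_dvd hdr ?_
      rw [abs_lt]
      rcases hcase with h | h <;> rw [h] <;> constructor <;> linarith
    rcases hcase with h | h
    · refine ⟨h, ?_⟩
      rw [h] at hz; linarith
    · rw [h] at hz; linarith
  have hr0 : r = 0 := by
    by_contra h
    have : (p : ℤ) ≤ p ^ r := le_self_pow₀ (by omega) h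
    omega
  rw [hr0, add_zero] at hfr
  rw [huw.2, mul_one] at hSu
  have hfl : 2 * i + 1 ≤ f := by
    have : d * (2 * i + 1) ≤ d * f := by rw [← hs, ← hfr]; omega
    exact Nat.le_of_mul_le_mul_left this hd
  have hfu : f ≤ 2 * i + 3 := by
    have : d * f ≤ d * (2 * i + 3) := by
      rw [← hfr]
      have : d * (2 * i + 3) = s + 2 * d := by rw [hs]; ring
      omega
    exact Nat.le_of_mul_le_mul_left this hd
  have hQs : ∀ k, Q ^ (2 * i + 1 + k) = (p : ℤ) ^ (s + k * d) := by
    intro k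
    rw [hQ, ← pow_mul, hs]; congr 1; ring
  have huw' : u = w := by
    rcases hu with rfl | rfl <;> rcases hw with ⟨rfl, -⟩ | ⟨rfl, -⟩ <;> simp_all
  obtain hf | hf | hf : f = 2 * i + 1 + 0 ∨ f = 2 * i + 1 + 1 ∨ f = 2 * i + 1 + 2 := by omega
  · left
    rw [hf, hQs] at hSu
    have : w = -1 := by
      rcases hw with ⟨-, h⟩ | ⟨h, -⟩
      · rw [hf] at h; exact absurd h (by simp [parity_simps])
      · exact h
    have hes : e = s := by rw [hfr, hf, hs, add_zero]
    refine ⟨by rw [hSu, huw', this, neg_one_mul, zero_mul, add_zero], by omega⟩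
  · right; left
    rw [hf, hQs] at hSu
    have : w = 1 := by
      rcases hw with ⟨h, -⟩ | ⟨-, h⟩
      · exact h
      · rw [hf] at h; exact absurd h (by simp [parity_simps])
    have hes : e = s + d := by rw [hfr, hf, hs]; ring
    refine ⟨by rw [hSu, huw', this]; simp, by omega⟩
  · right; right
    rw [hf, hQs] at hSu
    have : w = -1 := by
      rcases hw with ⟨-, h⟩ | ⟨h, -⟩
      · rw [hf] at h; exact absurd h (by simp [parity_simps])
      · exact h
    have hes : e = s + 2 * d := by rw [hfr, hf, hs]; ring
    refine ⟨by rw [hSu, huw', this]; simp, by omega⟩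

end FiniteField

section KernelBound

variable {F : Type} [Field F] [Fintype F] [DecidableEq F]

/-- A nondegenerate `τ`-polynomial of degree two over a field has at most `n ^ 2` roots, where `n`
is the size of the fixed field of `τ`. -/
lemma card_roots_semilinear_le (τ : F →+* F) {α β γ : F} (hγ : γ ≠ 0) :
    #{x : F | α * x + β * τ x + γ * τ (τ x) = 0} ≤ #{x : F | τ x = x} ^ 2 := by
  have hn : 1 ≤ #{x : F | τ x = x} := card_pos.2 ⟨0, by simp⟩
  set n := #{x : F | τ x = x} with hn_def
  by_cases htriv : ∀ v, α * v + β * τ v + γ * τ (τ v) = 0 → v = 0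
  · calc _ ≤ #({0} : Finset F) := card_le_card fun v hv => by
          simpa using htriv v (by simpa using hv)
      _ ≤ n ^ 2 := by rw [card_singleton]; exact Nat.one_le_pow _ _ hn
  push Not at htriv
  obtain ⟨v, hv, hv0⟩ := htriv
  set Z : Finset F := {z : F | γ * τ (τ v) * τ z = α * v * z} with hZ
  have hτv : τ (τ v) ≠ 0 := by simpa using hv0
  have hZn : #Z ≤ n := by
    by_cases hz : ∃ z₀ ∈ Z, z₀ ≠ 0
    · obtain ⟨z₀, hz₀, hz0⟩ := hz
      refine card_le_card_of_injOn (fun z => z / z₀) ?_ ?_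
      · intro z hz
        simp only [hZ, coe_filter, mem_filter, mem_univ, true_and, Set.mem_ofPred_eq] at hz hz₀ ⊢
        have hτz : τ z₀ ≠ 0 := by simpa using hz0
        rw [map_div₀, div_eq_div_iff hτz hz0]
        refine mul_left_cancel₀ (mul_ne_zero hγ hτv) ?_
        linear_combination z₀ * hz - z * hz₀
      · intro x _ y _ hxy
        exact (div_left_inj' hz0).1 hxy
    · push Not at hz
      refine le_trans (card_le_card (t := {0}) fun z h => ?_) (by simpa using hn)
      simpa using hz z h
  set W : Finset F := {x : F | α * x + β * τ x + γ * τ (τ x) = 0} with hW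
  calc #W ≤ n * #(W.image fun x => τ (x / v) - x / v) := by
        refine card_le_mul_card_image _ _ fun z hz => ?_
        obtain ⟨x₀, -, rfl⟩ := mem_image.1 hz
        refine card_le_card_of_injOn (fun x => (x - x₀) / v) ?_ ?_
        · intro x hx
          simp only [coe_filter, mem_univ, true_and, Set.mem_ofPred_eq] at hx ⊢
          rw [sub_div, map_sub]
          linear_combination hx.2
        · intro x _ y _ hxy
          have := (div_left_inj' hv0).1 hxy
          exact sub_left_injective this
    _ ≤ n * #Z := by
        refine Nat.mul_le_mul_left _ (card_le_card ?_)
        intro z hz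
        obtain ⟨x, hx, rfl⟩ := mem_image.1 hz
        simp only [hZ, hW, mem_filter, mem_univ, true_and] at hx ⊢
        obtain ⟨w, rfl⟩ : ∃ w, x = v * w := ⟨x / v, by field_simp⟩
        rw [mul_div_cancel_left₀ _ hv0]
        simp only [map_mul, map_sub] at hx ⊢
        linear_combination hx - τ w * hv
    _ ≤ n ^ 2 := by rw [sq]; exact Nat.mul_le_mul_left _ hZn

end KernelBound

section TraceForm

variable (p : ℕ) {F : Type} [Field F] [Algebra (ZMod p) F]

/-- The quadratic form `x ↦ Tr (a x ^ (p ^ s + 1) / 2 + b x ^ (p ^ l + 1))`. -/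
noncomputable def traceQuad (s l : ℕ) (a b : F) (x : F) : ZMod p :=
  Algebra.trace (ZMod p) F (2⁻¹ * a * x ^ (p ^ s + 1) + b * x ^ (p ^ l + 1))

/-- The linear operator representing the polarization of `traceQuad` with respect to the trace
pairing. -/
noncomputable def tracePolar [Fact p.Prime] [CharP F p] (s l : ℕ) (a b : F) :
    F →ₗ[ZMod p] F :=
  AddMonoidHom.toZModLinearMap p
    ((AddMonoidHom.mulLeft a).comp (iterateFrobenius F p s).toAddMonoidHom
      + (AddMonoidHom.mulLeft b).comp (iterateFrobenius F p l).toAddMonoidHom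
      + (iterateFrobenius F p (2 * s - l)).toAddMonoidHom.comp (AddMonoidHom.mulLeft b))

variable {p} [Fact p.Prime] [CharP F p]

lemma tracePolar_apply (s l : ℕ) (a b x : F) :
    tracePolar p s l a b x = a * x ^ p ^ s + b * x ^ p ^ l + (b * x) ^ p ^ (2 * s - l) := rfl

omit [Algebra (ZMod p) F] in
lemma trp_two_mul (s : ℕ) (v : F) : trp p (2 * s) v = trp p s (v + v ^ p ^ s) := by
  rw [trp, trp, two_mul, sum_range_add, ← sum_add_distrib]
  refine sum_congr rfl fun i _ => ?_
  rw [add_pow_char_pow, ← pow_mul, pow_add]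

omit [Algebra (ZMod p) F] in
lemma two_ne_zero_of_odd (hodd : Odd p) : (2 : F) ≠ 0 := by
  have h : ((2 : ℕ) : F) ≠ 0 := by
    rw [Ne, CharP.cast_eq_zero_iff F p, Nat.prime_dvd_prime_iff_eq Fact.out Nat.prime_two]
    rintro rfl
    exact absurd hodd (by decide)
  exact_mod_cast h

omit [Algebra (ZMod p) F] in
lemma inv_two_pow_prime_pow (k : ℕ) : (2⁻¹ : F) ^ p ^ k = 2⁻¹ := by
  rw [← iterateFrobenius_def, map_inv₀, map_ofNat]

variable [Fintype F]

omit [CharP F p] in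
lemma trace_pow_prime_pow (k : ℕ) (x : F) :
    Algebra.trace (ZMod p) F (x ^ p ^ k) = Algebra.trace (ZMod p) F x := by
  induction k with
  | zero => simp
  | succ k ih =>
    rw [pow_succ, pow_mul, ← ih]
    have := Algebra.trace_eq_of_algEquiv
      (FiniteField.frobeniusAlgEquivOfAlgebraic (ZMod p) F) (x ^ p ^ k)
    simpa using this

variable {s l d : ℕ} (hF : Fintype.card F = p ^ (2 * s))

include hF

omit [CharP F p] in
lemma algebraMap_trace_eq_trp (x : F) :
    algebraMap (ZMod p) F (Algebra.trace (ZMod p) F x) = trp p (2 * s) x := by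
  have h : Module.finrank (ZMod p) F = 2 * s := by
    have := Module.card_eq_pow_finrank (K := ZMod p) (V := F)
    rw [ZMod.card, hF] at this
    exact (Nat.pow_right_injective (Fact.out : p.Prime).two_le this).symm
  rw [FiniteField.algebraMap_trace_eq_sum_pow, h, Nat.card_eq_fintype_card, ZMod.card, trp]

omit [Algebra (ZMod p) F] [Fact p.Prime] [CharP F p] in
lemma pow_prime_pow_two_mul (x : F) : x ^ p ^ (2 * s) = x := by
  rw [← hF, FiniteField.pow_card]

lemma cword_eq (hodd : Odd p) {a : F} (ha : a ^ p ^ s = a) (b c : F) (h : ZMod p) (x : F) :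
    cword p s l a b c h x
      = algebraMap (ZMod p) F (traceQuad p s l a b x + Algebra.trace (ZMod p) F (c * x) + h) := by
  have h2 := two_ne_zero_of_odd (F := F) hodd
  set u := a * x ^ (p ^ s + 1) with hu
  have hus : u ^ p ^ s = u := by
    rw [hu, mul_pow, ha, ← pow_mul, add_mul, one_mul, pow_add, ← pow_add p, ← two_mul,
      pow_prime_pow_two_mul hF, pow_succ, mul_comm x]
  have e : trp p s u = trp p (2 * s) (2⁻¹ * u) := by
    rw [trp_two_mul, mul_pow, inv_two_pow_prime_pow, hus]
    congr 1; field_simp; norm_num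
  have hh : (ZMod.cast h : F) = algebraMap (ZMod p) F h :=
    RingHom.congr_fun (Subsingleton.elim (ZMod.castHom (dvd_refl p) F) (algebraMap _ _)) h
  rw [cword, traceQuad, e, ← map_add, ← algebraMap_trace_eq_trp hF,
    ← algebraMap_trace_eq_trp hF, hh, ← map_add, ← map_add]
  congr 1
  simp only [map_add]
  rw [hu, ← mul_assoc]
  ring

lemma traceQuad_add (hodd : Odd p) (hl : l ≤ 2 * s) {a : F} (ha : a ^ p ^ s = a) (b x y : F) :
    traceQuad p s l a b (x + y) = traceQuad p s l a b x + traceQuad p s l a b y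
      + Algebra.trace (ZMod p) F (tracePolar p s l a b x * y) := by
  have h2 := two_ne_zero_of_odd (F := F) hodd
  have e1 : Algebra.trace (ZMod p) F (2⁻¹ * a * (x * y ^ p ^ s))
      = Algebra.trace (ZMod p) F (2⁻¹ * a * (x ^ p ^ s * y)) := by
    rw [← trace_pow_prime_pow s]
    congr 1
    rw [mul_pow, mul_pow, inv_two_pow_prime_pow, ha, mul_pow, ← pow_mul, ← pow_add, ← two_mul,
      pow_prime_pow_two_mul hF]
  have e2 : Algebra.trace (ZMod p) F (b * (x * y ^ p ^ l))
      = Algebra.trace (ZMod p) F ((b * x) ^ p ^ (2 * s - l) * y) := by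
    rw [← trace_pow_prime_pow (2 * s - l)]
    congr 1
    rw [← mul_assoc, mul_pow, ← pow_mul, ← pow_add, Nat.add_sub_cancel' hl,
      pow_prime_pow_two_mul hF]
  have e3 : tracePolar p s l a b x * y = 2⁻¹ * a * (x ^ p ^ s * y) + 2⁻¹ * a * (x ^ p ^ s * y)
      + b * (x ^ p ^ l * y) + (b * x) ^ p ^ (2 * s - l) * y := by
    rw [tracePolar_apply]
    field_simp
    ring
  rw [e3, map_add, map_add, map_add, ← e2]
  nth_rewrite 1 [← e1]
  simp only [traceQuad, ← map_add]
  congr 1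
  rw [pow_succ, pow_succ, add_pow_char_pow, add_pow_char_pow]
  ring

omit [Fintype F] [Fact p.Prime] [CharP F p] hF in
lemma traceQuad_neg (hodd : Odd p) (a b x : F) :
    traceQuad p s l a b (-x) = traceQuad p s l a b x := by
  have h : ∀ k, Even (p ^ k + 1) := fun k => (hodd.pow).add_odd odd_one
  rw [traceQuad, traceQuad, (h s).neg_pow, (h l).neg_pow]

end TraceForm

section Hermitian

variable {p : ℕ} [Fact p.Prime] {F : Type} [Field F] [Algebra (ZMod p) F] {d i j : ℕ}

omit [Fact p.Prime] [Algebra (ZMod p) F] in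
lemma pow_succ_eq_of_odd_mul {t : F} (ht : t ^ p ^ (2 * d) = t) (i : ℕ) :
    t ^ (p ^ (d * (2 * i + 1)) + 1) = t ^ (p ^ d + 1) := by
  rw [pow_succ, pow_succ, show d * (2 * i + 1) = d + 2 * d * i by ring,
    pow_prime_pow_add_mul ht]

omit [Fact p.Prime] [Algebra (ZMod p) F] in
lemma pow_prime_pow_two_mul_of_pow_eq_one {t : F} {k : ℕ} (ht : t ^ (p ^ k + 1) = 1) :
    t ^ p ^ (2 * k) = t := by
  have ht0 : t ≠ 0 := by
    rintro rfl
    simp at ht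
  have h1 : t ^ p ^ k = t⁻¹ := eq_inv_of_mul_eq_one_left (by rwa [pow_succ] at ht)
  rw [two_mul, pow_add, pow_mul, h1, inv_pow, h1, inv_inv]

omit [Algebra (ZMod p) F] in
lemma pow_eq_one_and_iff [CharP F p] (hc : Nat.gcd (d * (2 * i + 1)) (d * (2 * j + 1)) = d)
    (t : F) :
    t ^ (p ^ (d * (2 * i + 1)) + 1) = 1 ∧ t ^ (p ^ (d * (2 * j + 1)) + 1) = 1
      ↔ t ^ (p ^ d + 1) = 1 := by
  constructor
  · rintro ⟨h1, h2⟩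
    have h := pow_prime_pow_gcd (pow_prime_pow_two_mul_of_pow_eq_one h1)
      (pow_prime_pow_two_mul_of_pow_eq_one h2)
    rw [Nat.gcd_mul_left, hc] at h
    rwa [← pow_succ_eq_of_odd_mul h i]
  · intro h
    have h' := pow_prime_pow_two_mul_of_pow_eq_one h
    exact ⟨by rwa [pow_succ_eq_of_odd_mul h'], by rwa [pow_succ_eq_of_odd_mul h']⟩

variable [Fintype F] (hF : Fintype.card F = p ^ (2 * (d * (2 * i + 1))))

include hF

omit [Fact p.Prime] [Field F] [Algebra (ZMod p) F] in
lemma pow_sub_one_dvd_card_sub_one : p ^ (2 * d) - 1 ∣ Fintype.card F - 1 := by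
  rw [hF, show 2 * (d * (2 * i + 1)) = 2 * d * (2 * i + 1) by ring, pow_mul _ (2 * d)]
  exact Nat.sub_one_dvd_pow_sub_one _ _

omit [Fact p.Prime] [Field F] [Algebra (ZMod p) F] in
lemma pow_add_one_dvd_card_sub_one :
    (p ^ d + 1) * (p ^ d - 1) ∣ Fintype.card F - 1 := by
  have : (p ^ d + 1) * (p ^ d - 1) = p ^ (2 * d) - 1 := by
    have := Nat.sq_sub_sq (p ^ d) 1
    rw [one_pow, ← pow_mul, mul_comm d] at this
    exact this.symm
  exact this ▸ pow_sub_one_dvd_card_sub_one hF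

lemma exists_scaling (a b : F) {v : ZMod p} (hv : v ≠ 0) :
    ∃ t : F, t ≠ 0 ∧ ∀ x, traceQuad p (d * (2 * i + 1)) (d * (2 * j + 1)) a b (t * x)
      = v * traceQuad p (d * (2 * i + 1)) (d * (2 * j + 1)) a b x := by
  have hp : p.Prime := Fact.out
  obtain ⟨e, he⟩ := pow_add_one_dvd_card_sub_one hF
  set V := algebraMap (ZMod p) F v with hV
  have hV0 : V ≠ 0 := by simpa [hV] using hv
  have hVd : V ^ p ^ d = V := by
    rw [hV, ← map_pow, ZMod.pow_card_pow]
  have hVe : V ^ ((p ^ d - 1) * e) = 1 := by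
    have : V ^ (p ^ d - 1) = 1 := by
      refine mul_right_cancel₀ hV0 ?_
      rw [← pow_succ, Nat.sub_add_cancel (Nat.one_le_pow _ _ hp.pos), hVd, one_mul]
    rw [pow_mul, this, one_pow]
  obtain ⟨t, ht⟩ := exists_pow_eq_of_pow_eq_one_s11 (he.trans (mul_assoc _ _ _)).symm hVe
  have ht0 : t ≠ 0 := by
    rintro rfl
    exact hV0 (by rw [← ht, zero_pow (Nat.succ_ne_zero _)])
  have ht2 : t ^ p ^ (2 * d) = t := by
    have h1 : t ^ p ^ d = V / t := by rw [eq_div_iff ht0, ← pow_succ, ht]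
    rw [two_mul, pow_add, pow_mul, h1, div_pow, hVd, h1]
    field_simp
  refine ⟨t, ht0, fun x => ?_⟩
  rw [traceQuad, traceQuad, mul_pow, mul_pow, pow_succ_eq_of_odd_mul ht2,
    pow_succ_eq_of_odd_mul ht2, ht,
    ← smul_eq_mul (α := ZMod p), ← map_smul, Algebra.smul_def]
  congr 1
  ring

lemma dvd_levelDiff_traceQuad_sub_one (a b : F) :
    ((p : ℤ) ^ d + 1) ∣
      levelDiff (traceQuad p (d * (2 * i + 1)) (d * (2 * j + 1)) a b) - 1 := by
  classical
  have hp : p.Prime := Fact.out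
  have := dvd_levelDiff_sub_one (k := p ^ d + 1) (Nat.succ_pos _)
    (dvd_of_mul_right_dvd (pow_add_one_dvd_card_sub_one hF))
    (q := traceQuad p (d * (2 * i + 1)) (d * (2 * j + 1)) a b) (by simp [traceQuad])
    (fun t x ht => by
      have h' := pow_prime_pow_two_mul_of_pow_eq_one ht
      rw [traceQuad, traceQuad, mul_pow, mul_pow, pow_succ_eq_of_odd_mul h',
        pow_succ_eq_of_odd_mul h', ht, one_mul, one_mul])
  exact_mod_cast this

variable [CharP F p]

lemma card_ker_tracePolar (hd : 0 < d)
    (hg : Nat.gcd (d * (2 * i + 1) + d * (2 * j + 1)) (2 * (d * (2 * j + 1))) = 2 * d)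
    (hl : d * (2 * j + 1) ≤ 2 * (d * (2 * i + 1))) {a b : F} (hab : a ≠ 0 ∨ b ≠ 0) :
    ∃ e ≤ 4 * d, Nat.card
      (LinearMap.ker (tracePolar p (d * (2 * i + 1)) (d * (2 * j + 1)) a b)) = p ^ e := by
  classical
  have hp : p.Prime := Fact.out
  set s := d * (2 * i + 1) with hs
  set l := d * (2 * j + 1)
  set K := LinearMap.ker (tracePolar p s l a b) with hK
  have hcard : Nat.card K = p ^ Module.finrank (ZMod p) K := by
    rw [Module.natCard_eq_pow_finrank (K := ZMod p), Nat.card_zmod]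
  refine ⟨_, ?_, hcard⟩
  have hle : Nat.card K ≤ p ^ (4 * d) := by
    by_cases hb : b = 0
    · have : K = ⊥ := by
        rw [eq_bot_iff]
        intro x hx
        have ha : a ≠ 0 := hab.resolve_right (not_not.2 hb)
        rw [hK, LinearMap.mem_ker, tracePolar_apply, hb] at hx
        simpa [ha, hp.ne_zero] using hx
      rw [this, Nat.card_unique]
      exact Nat.one_le_pow _ _ hp.pos
    · set τ := iterateFrobenius F p (s + l)
      have hτ : ∀ x : F, τ x = x ^ p ^ (s + l) := fun x => iterateFrobenius_def _ _ _
      have h1 : Nat.card K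
          ≤ #{x : F | b * x + a ^ p ^ l * τ x + b ^ p ^ l * τ (τ x) = 0} := by
        rw [← Nat.card_eq_finsetCard]
        refine Nat.card_le_card_of_injective (fun x : K => ⟨x.1, ?_⟩) ?_
        · have hx : tracePolar p s l a b x = 0 := x.2
          rw [tracePolar_apply] at hx
          have hx' := congrArg (· ^ p ^ l) hx
          simp only [add_pow_char_pow, mul_pow, ← pow_mul, ← pow_add,
            zero_pow (pow_ne_zero _ hp.ne_zero)] at hx'
          rw [Nat.sub_add_cancel hl, pow_prime_pow_two_mul hF, pow_prime_pow_two_mul hF] at hx'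
          simp only [mem_filter, mem_univ, true_and, hτ]
          rw [← pow_mul, ← pow_add, show s + l + (s + l) = 2 * s + (l + l) by ring,
            pow_add _ (2 * s), pow_mul _ (p ^ (2 * s)), pow_prime_pow_two_mul hF, ← hx']
          ring
        · intro x y hxy
          exact Subtype.ext (congrArg (fun z => z.1) hxy)
      have h2 : #{x : F | τ x = x} ≤ p ^ (2 * d) := by
        have hg' : Nat.gcd (s + l) (2 * s) = 2 * d := by
          rw [← hg]
          refine Nat.dvd_antisymm (Nat.dvd_gcd (Nat.gcd_dvd_left _ _) ?_)
            (Nat.dvd_gcd (Nat.gcd_dvd_left _ _) ?_)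
          · refine (Nat.dvd_add_right (Nat.gcd_dvd_right (s + l) (2 * s))).1 ?_
            rw [← mul_add 2 s l]
            exact (Nat.gcd_dvd_left _ _).mul_left 2
          · refine (Nat.dvd_add_left (Nat.gcd_dvd_right (s + l) (2 * l))).1 ?_
            rw [← mul_add 2 s l]
            exact (Nat.gcd_dvd_left _ _).mul_left 2
        calc _ ≤ #{x : F | x ^ p ^ (2 * d) = x} := by
              refine card_le_card fun x hx => ?_
              simp only [mem_filter, mem_univ, true_and, hτ] at hx ⊢
              rw [← hg']
              exact pow_prime_pow_gcd hx (pow_prime_pow_two_mul hF x)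
          _ = p ^ (2 * d) := card_pow_eq_self (Nat.one_lt_pow (by omega) hp.one_lt)
              (pow_sub_one_dvd_card_sub_one hF)
      calc Nat.card K ≤ _ := h1
        _ ≤ _ := card_roots_semilinear_le τ (pow_ne_zero _ hb)
        _ ≤ (p ^ (2 * d)) ^ 2 := Nat.pow_le_pow_left h2 2
        _ = p ^ (4 * d) := by rw [← pow_mul]; congr 1; ring
  rw [hcard] at hle
  exact (Nat.pow_le_pow_iff_right hp.one_lt).1 hle

omit [CharP F p] hF in
lemma trace_nondegenerate (a : F) (h : ∀ x, Algebra.trace (ZMod p) F (a * x) = 0) : a = 0 :=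
  (traceForm_nondegenerate (ZMod p) F).1 a h

/-- The possible exponential sums of the forms `traceQuad`, with the sizes of the radicals. -/
lemma levelDiff_traceQuad (hodd : Odd p) (hd : 0 < d)
    (hg : Nat.gcd (d * (2 * i + 1) + d * (2 * j + 1)) (2 * (d * (2 * j + 1))) = 2 * d)
    (hl : d * (2 * j + 1) ≤ 2 * (d * (2 * i + 1))) {s l : ℕ} (hs : s = d * (2 * i + 1))
    (hlj : l = d * (2 * j + 1)) {a b : F} (ha : a ^ p ^ s = a) (hab : a ≠ 0 ∨ b ≠ 0) :
    (levelDiff (traceQuad p s l a b) = -(p : ℤ) ^ s ∨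
      levelDiff (traceQuad p s l a b) = (p : ℤ) ^ (s + d) ∨
      levelDiff (traceQuad p s l a b) = -(p : ℤ) ^ (s + 2 * d)) := by
  classical
  have hp2 : p ≠ 2 := by rintro rfl; exact absurd hodd (by decide)
  subst hs hlj
  obtain ⟨e, he, hker⟩ := card_ker_tracePolar (j := j) hF hd hg hl hab
  have hsq := levelDiff_sq hp2 trace_nondegenerate (traceQuad_add hF hodd hl ha b)
    (traceQuad_neg hodd a b) (fun v hv => exists_scaling hF a b hv)
  rw [hker, hF] at hsq
  push_cast at hsq
  rcases eq_of_sq_eq_of_dvd_sub_one Fact.out hodd hd rfl hsq he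
    (dvd_levelDiff_traceQuad_sub_one hF a b) with h | h | h
  · exact Or.inl h.1
  · exact Or.inr (Or.inl h.1)
  · exact Or.inr (Or.inr h.1)

end Hermitian

section Moments

variable {p : ℕ} [Fact p.Prime] {F : Type} [Field F] [Fintype F] [DecidableEq F]
  [Algebra (ZMod p) F] {s l : ℕ}

/-- The first moment of the exponential sums of the forms `traceQuad`. -/
lemma sum_levelDiff_traceQuad
    (hq : ∀ a b : F, ∀ v : ZMod p, v ≠ 0 →
      ∃ t : F, t ≠ 0 ∧ ∀ x, traceQuad p s l a b (t * x) = v * traceQuad p s l a b x)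
    (A : Finset F) :
    ∑ a ∈ A, ∑ b, levelDiff (traceQuad p s l a b) = Fintype.card F * #A := by
  have hψ := ZMod.isPrimitive_stdAddChar p
  set ψ : AddChar (ZMod p) ℂ := ZMod.stdAddChar
  have hψ0 : ψ ≠ 0 := by
    rintro h
    exact hψ one_ne_zero (by ext; simp [h])
  have key : ∑ a ∈ A, ∑ b, (levelDiff (traceQuad p s l a b) : ℂ) = Fintype.card F * #A := by
    have : ∀ a : F, ∑ b, (levelDiff (traceQuad p s l a b) : ℂ) = Fintype.card F := by
      intro a
      calc ∑ b, (levelDiff (traceQuad p s l a b) : ℂ)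
          = ∑ b, ∑ x, ψ (traceQuad p s l a b x) :=
            sum_congr rfl fun b _ => (sum_addChar_eq_levelDiff (hq a b) hψ0).symm
        _ = ∑ x, ψ (Algebra.trace (ZMod p) F (2⁻¹ * a * x ^ (p ^ s + 1))) *
              ∑ b, ψ (Algebra.trace (ZMod p) F (x ^ (p ^ l + 1) * b)) := by
            rw [sum_comm]
            refine sum_congr rfl fun x _ => ?_
            rw [mul_sum]
            refine sum_congr rfl fun b _ => ?_
            rw [traceQuad, map_add, AddChar.map_add_eq_mul, mul_comm b]
        _ = ∑ x : F, if x = 0 then (Fintype.card F : ℂ) else 0 := by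
            refine sum_congr rfl fun x _ => ?_
            rw [sum_addChar_mul trace_nondegenerate hψ]
            by_cases hx : x = 0 <;> simp [hx]
        _ = _ := by simp
    rw [sum_congr rfl fun a _ => this a, sum_const, nsmul_eq_mul, mul_comm]
  exact_mod_cast key

/-- Orthogonality of characters over the subfield of order `p ^ s`. -/
lemma sum_addChar_subfield [CharP F p] (hF : Fintype.card F = p ^ (2 * s)) (hodd : Odd p)
    {ψ : AddChar (ZMod p) ℂ} (hψ : ψ.IsPrimitive) {u : F} (hu : u ^ p ^ s = u) :
    ∑ a : F with a ^ p ^ s = a, ψ (Algebra.trace (ZMod p) F (2⁻¹ * a * u))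
      = if u = 0 then (#{a : F | a ^ p ^ s = a} : ℂ) else 0 := by
  split_ifs with h0
  · simp [h0]
  · obtain ⟨w, hw⟩ : ∃ w, ψ (Algebra.trace (ZMod p) F (u * w)) ≠ 1 := by
      by_contra! h
      have h1 := sum_addChar_mul (T := Algebra.trace (ZMod p) F) trace_nondegenerate hψ u
      rw [if_neg h0, sum_congr rfl fun x _ => h x] at h1
      simp at h1
    set a₀ := w + w ^ p ^ s with ha₀
    have hfix : a₀ ^ p ^ s = a₀ := by
      rw [ha₀, add_pow_char_pow, ← pow_mul, ← pow_add, ← two_mul, pow_prime_pow_two_mul hF,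
        add_comm]
    have htr : Algebra.trace (ZMod p) F (2⁻¹ * a₀ * u) = Algebra.trace (ZMod p) F (u * w) := by
      have h1 : Algebra.trace (ZMod p) F (2⁻¹ * (u * w ^ p ^ s))
          = Algebra.trace (ZMod p) F (2⁻¹ * (u * w)) := by
        rw [← trace_pow_prime_pow s (2⁻¹ * (u * w)), mul_pow, mul_pow, inv_two_pow_prime_pow, hu]
      have h2 : 2⁻¹ * a₀ * u = 2⁻¹ * (u * w) + 2⁻¹ * (u * w ^ p ^ s) := by rw [ha₀]; ring
      rw [h2, map_add, h1, ← map_add]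
      congr 1
      have := two_ne_zero_of_odd (F := F) hodd
      field_simp
      ring
    set S := ∑ a : F with a ^ p ^ s = a, ψ (Algebra.trace (ZMod p) F (2⁻¹ * a * u))
    have hS : ψ (Algebra.trace (ZMod p) F (u * w)) * S = S := by
      rw [mul_sum]
      refine sum_bij (fun a _ => a₀ + a) ?_ ?_ ?_ ?_
      · intro a ha
        simp only [mem_filter, mem_univ, true_and] at ha ⊢
        rw [add_pow_char_pow, hfix, ha]
      · intro a _ b _ hab
        exact add_left_cancel hab
      · intro a ha
        simp only [mem_filter, mem_univ, true_and] at ha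
        refine ⟨a - a₀, ?_, by ring⟩
        simp only [mem_filter, mem_univ, true_and]
        rw [sub_pow_char_pow, hfix, ha]
      · intro a _
        rw [← htr, ← AddChar.map_add_eq_mul, ← map_add]
        congr 2
        ring
    have : (ψ (Algebra.trace (ZMod p) F (u * w)) - 1) * S = 0 := by
      rw [sub_mul, hS, one_mul, sub_self]
    exact (mul_eq_zero.1 this).resolve_left (sub_ne_zero.2 hw)

/-- The second moment of the exponential sums of the forms `traceQuad`. -/
lemma sum_levelDiff_traceQuad_sq [CharP F p] (hF : Fintype.card F = p ^ (2 * s)) (hodd : Odd p)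
    (hq : ∀ a b : F, ∀ v : ZMod p, v ≠ 0 →
      ∃ t : F, t ≠ 0 ∧ ∀ x, traceQuad p s l a b (t * x) = v * traceQuad p s l a b x) :
    ∑ a : F with a ^ p ^ s = a, ∑ b, levelDiff (traceQuad p s l a b) ^ 2
      = Fintype.card F * #{a : F | a ^ p ^ s = a} *
        #{z : F × F | z.1 ^ (p ^ s + 1) = z.2 ^ (p ^ s + 1)
          ∧ z.1 ^ (p ^ l + 1) = z.2 ^ (p ^ l + 1)} := by
  have hψ := ZMod.isPrimitive_stdAddChar p
  set ψ : AddChar (ZMod p) ℂ := ZMod.stdAddChar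
  have hψ0 : ψ ≠ 0 := by
    rintro h
    exact hψ one_ne_zero (by ext; simp [h])
  have hψ1 : ψ⁻¹ ≠ 0 := by
    intro h; exact hψ0 (by rw [← inv_inv ψ, h]; rfl)
  set T := Algebra.trace (ZMod p) F
  have hnorm : ∀ x : F, (x ^ (p ^ s + 1)) ^ p ^ s = x ^ (p ^ s + 1) := by
    intro x
    rw [← pow_mul, add_mul, one_mul, pow_add, ← pow_add p, ← two_mul,
      pow_prime_pow_two_mul hF, pow_succ, mul_comm x]
  have key : ∑ a : F with a ^ p ^ s = a, ∑ b, (levelDiff (traceQuad p s l a b) : ℂ) ^ 2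
      = Fintype.card F * #{a : F | a ^ p ^ s = a} *
        #{z : F × F | z.1 ^ (p ^ s + 1) = z.2 ^ (p ^ s + 1)
          ∧ z.1 ^ (p ^ l + 1) = z.2 ^ (p ^ l + 1)} := by
    calc ∑ a : F with a ^ p ^ s = a, ∑ b, (levelDiff (traceQuad p s l a b) : ℂ) ^ 2
        = ∑ a : F with a ^ p ^ s = a, ∑ b, ∑ z : F × F,
            ψ (T (2⁻¹ * a * (z.1 ^ (p ^ s + 1) - z.2 ^ (p ^ s + 1)))) *
            ψ (T ((z.1 ^ (p ^ l + 1) - z.2 ^ (p ^ l + 1)) * b)) := by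
          refine sum_congr rfl fun a _ => sum_congr rfl fun b _ => ?_
          rw [sq]
          nth_rewrite 1 [← sum_addChar_eq_levelDiff (hq a b) hψ0]
          rw [← sum_addChar_eq_levelDiff (hq a b) hψ1, sum_mul_sum, ← sum_product']
          refine sum_congr rfl fun z _ => ?_
          rw [AddChar.inv_apply, ← AddChar.map_add_eq_mul, ← AddChar.map_add_eq_mul, traceQuad,
            traceQuad, ← map_neg, ← map_add, ← map_add]
          congr 2
          ring
      _ = ∑ z : F × F, (∑ a : F with a ^ p ^ s = a,
            ψ (T (2⁻¹ * a * (z.1 ^ (p ^ s + 1) - z.2 ^ (p ^ s + 1))))) *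
            ∑ b, ψ (T ((z.1 ^ (p ^ l + 1) - z.2 ^ (p ^ l + 1)) * b)) := by
          simp_rw [sum_mul_sum]
          rw [sum_comm]
          rw [sum_congr rfl fun b _ => sum_comm, sum_comm]
          exact sum_congr rfl fun z _ => sum_comm
      _ = ∑ z : F × F, if z.1 ^ (p ^ s + 1) = z.2 ^ (p ^ s + 1)
            ∧ z.1 ^ (p ^ l + 1) = z.2 ^ (p ^ l + 1)
            then (Fintype.card F * #{a : F | a ^ p ^ s = a} : ℂ) else 0 := by
          refine sum_congr rfl fun z _ => ?_
          rw [sum_addChar_mul trace_nondegenerate hψ, sum_addChar_subfield hF hodd hψ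
            (by rw [sub_pow_char_pow, hnorm, hnorm])]
          simp only [sub_eq_zero]
          split_ifs <;> simp_all [mul_comm]
      _ = _ := by
          rw [← sum_filter, sum_const, nsmul_eq_mul, mul_comm]
  exact_mod_cast key

omit [Algebra (ZMod p) F] in
lemma card_pairs [CharP F p] {d i j : ℕ}
    (hF : Fintype.card F = p ^ (2 * (d * (2 * i + 1))))
    (hc : Nat.gcd (d * (2 * i + 1)) (d * (2 * j + 1)) = d) :
    #{z : F × F | z.1 ^ (p ^ (d * (2 * i + 1)) + 1) = z.2 ^ (p ^ (d * (2 * i + 1)) + 1)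
        ∧ z.1 ^ (p ^ (d * (2 * j + 1)) + 1) = z.2 ^ (p ^ (d * (2 * j + 1)) + 1)}
      = 1 + (p ^ d + 1) * (Fintype.card F - 1) := by
  have hk := card_pow_eq_one (F := F) (k := p ^ d + 1) (Nat.succ_pos _)
    (dvd_of_mul_right_dvd (pow_add_one_dvd_card_sub_one hF))
  set S := ({z : F × F | z.1 ^ (p ^ (d * (2 * i + 1)) + 1) = z.2 ^ (p ^ (d * (2 * i + 1)) + 1)
        ∧ z.1 ^ (p ^ (d * (2 * j + 1)) + 1) = z.2 ^ (p ^ (d * (2 * j + 1)) + 1)}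
      : Finset (F × F)) with hS
  have h1 : (({t : F | t ^ (p ^ d + 1) = 1} : Finset F) ×ˢ (univ.erase (0 : F))).image
      (fun w => (w.1 * w.2, w.2)) = S.erase (0, 0) := by
    ext ⟨x, y⟩
    simp only [hS, mem_image, mem_product, mem_filter, mem_univ, true_and, mem_erase, and_true,
      Prod.mk.injEq, Prod.exists, ne_eq]
    constructor
    · rintro ⟨t, y', ⟨ht, hy⟩, rfl, rfl⟩
      have := (pow_eq_one_and_iff hc t).2 ht
      refine ⟨fun h => hy h.2, ?_, ?_⟩
      · rw [mul_pow, this.1, one_mul]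
      · rw [mul_pow, this.2, one_mul]
    · rintro ⟨h0, h1, h2⟩
      have hy : y ≠ 0 := by
        rintro rfl
        rw [zero_pow (Nat.succ_ne_zero _)] at h1
        exact h0 ⟨pow_eq_zero_iff (Nat.succ_ne_zero _) |>.1 h1, rfl⟩
      refine ⟨x / y, y, ⟨(pow_eq_one_and_iff hc _).1 ⟨?_, ?_⟩, hy⟩, div_mul_cancel₀ _ hy, rfl⟩
      · rw [div_pow, h1, div_self (pow_ne_zero _ hy)]
      · rw [div_pow, h2, div_self (pow_ne_zero _ hy)]
  have h2 : #(S.erase (0, 0)) = (p ^ d + 1) * (Fintype.card F - 1) := by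
    rw [← h1, card_image_of_injOn, card_product, hk, card_erase_of_mem (mem_univ _), card_univ]
    rintro ⟨t, y⟩ hy ⟨t', y'⟩ - h
    simp only [coe_product, Set.mem_prod, mem_coe, mem_erase] at hy
    simp only [Prod.mk.injEq] at h
    obtain ⟨h, rfl⟩ := h
    rw [mul_right_cancel₀ hy.2.1 h]
  rw [← h2, add_comm, card_erase_add_one]
  simp [hS]

end Moments

section Count

lemma weight_eq_iff {p s d N : ℕ} (hp : 2 ≤ p) (hds : d ≤ s) (hs : 0 < s) :
    p ^ (2 * s) - N = p ^ (s + d - 1) * (p - 1) * (p ^ (s - d) - 1) ∧ N ≤ p ^ (2 * s)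
      ↔ N = p ^ (2 * s - 1) + (p - 1) * p ^ (s + d - 1) := by
  obtain ⟨e, rfl⟩ := Nat.exists_eq_add_of_le hds
  obtain ⟨r, rfl⟩ := Nat.exists_eq_add_of_le hp
  obtain ⟨k, hk⟩ := Nat.exists_eq_add_of_le
    (show 1 ≤ (2 + r) ^ e from Nat.one_le_pow _ _ (by omega))
  have h1 : (2 + r) ^ (2 * (d + e) - 1) = (2 + r) ^ (d + e + d - 1) * (1 + k) := by
    rw [← hk, ← pow_add]; congr 1; omega
  have h2 : (2 + r) ^ (2 * (d + e)) = (2 + r) ^ (d + e + d - 1) * (1 + k) * (2 + r) := by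
    rw [← h1, ← pow_succ]; congr 1; omega
  rw [h1, h2, show d + e - d = e by omega, hk, show 2 + r - 1 = 1 + r by omega,
    show 1 + k - 1 = k by omega]
  generalize (2 + r) ^ (d + e + d - 1) = X
  have h3 : X * (1 + k) * (2 + r) = X * (1 + k) + (1 + r) * X + X * (1 + r) * k := by ring
  omega

lemma count_eq {x y : ℚ} {p s d : ℕ} (hp : 0 < p) (hsd : 2 * d ≤ s)
    (hx : (p : ℚ) ^ s * (p : ℚ) ^ (2 * s) * (1 + ((p : ℚ) ^ d + 1) * ((p : ℚ) ^ (2 * s) - 1))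
      + (p : ℚ) ^ s * (1 + ((p : ℚ) ^ d) ^ 2) * ((p : ℚ) ^ s * (p : ℚ) ^ (2 * s))
      + ((p : ℚ) ^ s) ^ 2 * ((p : ℚ) ^ d) ^ 2 * ((p : ℚ) ^ s * (p : ℚ) ^ (2 * s))
      = x * (((p : ℚ) ^ s) ^ 2 * (p : ℚ) ^ d * ((p : ℚ) ^ d + 1) ^ 2)
        + ((p : ℚ) ^ (2 * s) + (p : ℚ) ^ s) * ((p : ℚ) ^ (2 * s) + (p : ℚ) ^ (s + 2 * d)))
    (hy : y * (p : ℚ) ^ (2 * d) = x * (p : ℚ) ^ (2 * s)) :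
    y = (p : ℚ) ^ (2 * s - d) * ((p : ℚ) ^ s + (p : ℚ) ^ (s - d) + (p : ℚ) ^ (s - 2 * d) + 1)
          * ((p : ℚ) ^ (2 * s) - 1) / ((p : ℚ) ^ d + 1) ^ 2 := by
  obtain ⟨e, rfl⟩ := Nat.exists_eq_add_of_le hsd
  rw [show 2 * d + e - d = d + e by omega, show 2 * d + e - 2 * d = e by omega,
    show 2 * (2 * d + e) - d = 3 * d + 2 * e by omega]
  have hQ : (0 : ℚ) < (p : ℚ) ^ d := by positivity
  have hE : (0 : ℚ) < (p : ℚ) ^ e := by positivity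
  simp only [pow_add, mul_add, pow_mul'] at hx hy ⊢
  generalize (p : ℚ) ^ d = Q at *
  generalize (p : ℚ) ^ e = E at *
  have hQ1 : Q + 1 ≠ 0 := by positivity
  have hx' : x * (Q * (Q + 1) ^ 2)
      = ((Q ^ 2 * E) ^ 2 - 1) * (Q ^ 2 * E * (Q ^ 2 + Q + 1) + Q ^ 2) := by
    have : (Q ^ 2 * E) ^ 2 ≠ 0 := by positivity
    refine mul_left_cancel₀ this ?_
    linear_combination -hx
  have hy' : y = x * (Q * E) ^ 2 := by
    have : Q ^ 2 ≠ 0 := by positivity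
    refine mul_right_cancel₀ this ?_
    linear_combination hy
  rw [hy', eq_div_iff (by positivity)]
  have : Q ≠ 0 := hQ.ne'
  refine mul_left_cancel₀ this ?_
  linear_combination (Q * E) ^ 2 * hx'

end Count

section Codewords

variable {p : ℕ} [Fact p.Prime] {F : Type} [Field F] [Fintype F] [DecidableEq F]

lemma card_suppw_eq_iff [Algebra (ZMod p) F] [CharP F p] {s l d : ℕ}
    (hF : Fintype.card F = p ^ (2 * s)) (hodd : Odd p) (hs : 0 < s) (hds : d ≤ s) {a : F}
    (ha : a ^ p ^ s = a) (b c : F) (h : ZMod p) :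
    (suppw p s l a b c h).card = p ^ (s + d - 1) * (p - 1) * (p ^ (s - d) - 1)
      ↔ #{x : F | traceQuad p s l a b x + Algebra.trace (ZMod p) F (c * x) + h = 0}
        = p ^ (2 * s - 1) + (p - 1) * p ^ (s + d - 1) := by
  have hsupp : suppw p s l a b c h
      = ({x : F | ¬ (traceQuad p s l a b x + Algebra.trace (ZMod p) F (c * x) + h = 0)} :
        Finset F) := by
    ext x
    simp only [suppw, mem_filter, mem_univ, true_and, cword_eq hF hodd ha, ne_eq,
      map_eq_zero]
  have hadd := card_filter_add_card_filter_not (s := (univ : Finset F))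
    (fun x => traceQuad p s l a b x + Algebra.trace (ZMod p) F (c * x) + h = 0)
  rw [card_univ, hF] at hadd
  rw [hsupp, ← weight_eq_iff (Fact.out : p.Prime).two_le hds hs]
  omega

omit [DecidableEq F] in
lemma levelDiff_traceQuad_zero [Algebra (ZMod p) F] (s l : ℕ) :
    levelDiff (traceQuad p s l (0 : F) 0) = Fintype.card F := by
  simp [levelDiff, levelCard, traceQuad]

variable [CharP F p] {d i j : ℕ}

lemma card_shifts_traceQuad [Algebra (ZMod p) F]
    (hF : Fintype.card F = p ^ (2 * (d * (2 * i + 1)))) (hodd : Odd p)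
    (hd : 0 < d) (hi : 0 < i)
    (hg : Nat.gcd (d * (2 * i + 1) + d * (2 * j + 1)) (2 * (d * (2 * j + 1))) = 2 * d)
    (hl : d * (2 * j + 1) ≤ 2 * (d * (2 * i + 1))) {s l : ℕ} (hs : s = d * (2 * i + 1))
    (hlj : l = d * (2 * j + 1)) {a : F} (ha : a ^ p ^ s = a) (b : F) :
    #{u : F × ZMod p | (suppw p s l a b u.1 u.2).card
        = p ^ (s + d - 1) * (p - 1) * (p ^ (s - d) - 1)} * p ^ (2 * d)
      = if levelDiff (traceQuad p s l a b) = (p : ℤ) ^ (s + d) then p ^ (2 * s) else 0 := by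
  have hp : p.Prime := Fact.out
  have hp2 : p ≠ 2 := by rintro rfl; exact absurd hodd (by decide)
  have hds : 3 * d ≤ s := by rw [hs]; nlinarith
  have hF' : Fintype.card F = p ^ (2 * s) := by rw [hF, hs]
  have hq : ∀ v : ZMod p, v ≠ 0 → ∃ t : F, t ≠ 0 ∧
      ∀ x, traceQuad p s l a b (t * x) = v * traceQuad p s l a b x := by
    subst hs hlj
    exact fun v hv => exists_scaling hF a b hv
  have hadd := traceQuad_add hF' hodd (by rw [hlj, hs]; exact hl : l ≤ 2 * s) ha b
  have hcases : levelDiff (traceQuad p s l a b) = (p : ℤ) ^ (2 * s) ∨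
      levelDiff (traceQuad p s l a b) = -(p : ℤ) ^ s ∨
      levelDiff (traceQuad p s l a b) = (p : ℤ) ^ (s + d) ∨
      levelDiff (traceQuad p s l a b) = -(p : ℤ) ^ (s + 2 * d) := by
    by_cases hab : a = 0 ∧ b = 0
    · left
      rw [hab.1, hab.2, levelDiff_traceQuad_zero, hF']
      push_cast
      rfl
    · right
      exact levelDiff_traceQuad hF hodd hd hg hl hs hlj ha (by tauto)
  set q := traceQuad p s l a b
  set M := p ^ (2 * s - 1) + (p - 1) * p ^ (s + d - 1) with hM
  have hpM : (p : ℤ) * M = (p : ℤ) ^ (2 * s) + (p - 1) * (p : ℤ) ^ (s + d) := by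
    have h1 : (p : ℤ) ^ (2 * s) = p * (p : ℤ) ^ (2 * s - 1) := by
      rw [← pow_succ']; congr 1; omega
    have h2 : (p : ℤ) ^ (s + d) = p * (p : ℤ) ^ (s + d - 1) := by
      rw [← pow_succ']; congr 1; omega
    rw [hM, h1, h2]
    push_cast [hp.one_le]
    ring
  have hp0 : (0 : ℤ) < p := by exact_mod_cast hp.pos
  have hp3 : (3 : ℤ) ≤ p := by
    have := hp.two_le
    omega
  have hlev := levelCard_add hq
  rw [hF'] at hlev
  push_cast at hlev
  have hN0 : (p : ℤ) * levelCard q 0 = (p : ℤ) ^ (2 * s) + (p - 1) * levelDiff q := by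
    rw [← hlev, levelDiff]; ring
  have hN1 : (p : ℤ) * levelCard q 1 = (p : ℤ) ^ (2 * s) - levelDiff q := by
    rw [← hlev, levelDiff]; ring
  have hM0 : p * M ≠ Fintype.card F := by
    intro h
    have h' : (p : ℤ) * M = (p : ℤ) ^ (2 * s) := by rw [hF'] at h; exact_mod_cast h
    have : (0 : ℤ) < (p - 1) * (p : ℤ) ^ (s + d) := by
      have : (0 : ℤ) < p - 1 := by linarith
      positivity
    linarith
  have hM1 : levelCard q 1 ≠ M := by
    intro h
    have h' : levelDiff q = - ((p - 1) * (p : ℤ) ^ (s + d)) := by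
      rw [h] at hN1; linarith
    have hs0 : (0 : ℤ) < (p : ℤ) ^ s := by positivity
    have hd1 : (p : ℤ) ≤ (p : ℤ) ^ d := by
      simpa using pow_le_pow_right₀ (by linarith : (1 : ℤ) ≤ p) hd
    have h2s : (0 : ℤ) < (p : ℤ) ^ (2 * s) := by positivity
    rw [pow_add] at hcases h'
    rw [pow_add, show 2 * d = d + d by ring, pow_add] at hcases
    generalize (p : ℤ) ^ s = P at *
    generalize (p : ℤ) ^ d = Q at *
    have hPQ : 0 < P * Q := by apply mul_pos hs0; linarith
    rcases hcases with h1 | h1 | h1 | h1 <;> rw [h1] at h'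
    · nlinarith
    · nlinarith
    · nlinarith
    · have : P * Q * (Q - (p - 1)) = 0 := by linarith
      have := (mul_eq_zero.1 this).resolve_left hPQ.ne'
      linarith
  have hiff : levelCard q 0 = M ↔ levelDiff q = (p : ℤ) ^ (s + d) := by
    constructor
    · intro h
      rw [h, hpM] at hN0
      exact (mul_left_cancel₀ (by linarith : (p - 1 : ℤ) ≠ 0) (by linarith)).symm
    · intro h
      rw [h, ← hpM] at hN0
      exact_mod_cast mul_left_cancel₀ hp0.ne' hN0
  have hT := trace_nondegenerate (p := p) (F := F)
  have hneg := traceQuad_neg (s := s) (l := l) hodd a b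
  have hcount := card_affine_shifts hp2 hT hadd hneg hq hM0 hM1
  have hsq := levelDiff_sq hp2 hT hadd hneg hq
  simp only [card_suppw_eq_iff hF' hodd (by omega : 0 < s) (by omega : d ≤ s) ha]
  simp only [hiff, hF'] at hcount
  split_ifs at hcount ⊢ with hc
  · rw [← hcount]
    congr 1
    rw [hc, hF', ← pow_mul] at hsq
    have h1 : p ^ (2 * s) * p ^ (2 * d)
        = p ^ (2 * s) * Nat.card (LinearMap.ker (tracePolar p s l a b)) := by
      rw [← pow_add, show 2 * s + 2 * d = (s + d) * 2 by ring]
      exact_mod_cast hsq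
    exact Nat.eq_of_mul_eq_mul_left (pow_pos hp.pos _) h1
  · have hK : Nat.card (LinearMap.ker (tracePolar p s l a b)) ≠ 0 := Nat.card_pos.ne'
    rw [(Nat.mul_eq_zero.1 hcount).resolve_right hK, zero_mul]

omit [CharP F p] in
lemma card_eq_sum_shifts (s : ℕ) (W : F → F → F → ZMod p → Prop)
    [∀ a b c h, Decidable (W a b c h)] :
    #{t : F × F × F × ZMod p | t.1 ^ p ^ s = t.1 ∧ W t.1 t.2.1 t.2.2.1 t.2.2.2}
      = ∑ a : F with a ^ p ^ s = a, ∑ b, #{u : F × ZMod p | W a b u.1 u.2} := by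
  rw [card_filter, Fintype.sum_prod_type, sum_filter]
  refine sum_congr rfl fun a _ => ?_
  rw [Fintype.sum_prod_type]
  split_ifs with ha
  · simp only [ha, true_and, card_filter]
  · simp [ha]

/-- The relation expressing the number of forms with exponential sum `p ^ (s + d)` through the
first two moments. -/
lemma card_levelDiff_eq [Algebra (ZMod p) F]
    (hF : Fintype.card F = p ^ (2 * (d * (2 * i + 1)))) (hodd : Odd p) (hd : 0 < d)
    (hi : 0 < i) (hc : Nat.gcd (d * (2 * i + 1)) (d * (2 * j + 1)) = d)
    (hg : Nat.gcd (d * (2 * i + 1) + d * (2 * j + 1)) (2 * (d * (2 * j + 1))) = 2 * d)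
    (hl : d * (2 * j + 1) ≤ 2 * (d * (2 * i + 1))) {s l : ℕ} (hs : s = d * (2 * i + 1))
    (hlj : l = d * (2 * j + 1)) :
    (p : ℤ) ^ s * (p : ℤ) ^ (2 * s) * (1 + ((p : ℤ) ^ d + 1) * ((p : ℤ) ^ (2 * s) - 1))
      + (p : ℤ) ^ s * (1 + ((p : ℤ) ^ d) ^ 2) * ((p : ℤ) ^ s * (p : ℤ) ^ (2 * s))
      + ((p : ℤ) ^ s) ^ 2 * ((p : ℤ) ^ d) ^ 2 * ((p : ℤ) ^ s * (p : ℤ) ^ (2 * s))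
      = (∑ a : F with a ^ p ^ s = a, ∑ b : F,
          if levelDiff (traceQuad p s l a b) = (p : ℤ) ^ (s + d) then 1 else 0)
            * (((p : ℤ) ^ s) ^ 2 * (p : ℤ) ^ d * ((p : ℤ) ^ d + 1) ^ 2)
        + ((p : ℤ) ^ (2 * s) + (p : ℤ) ^ s) * ((p : ℤ) ^ (2 * s) + (p : ℤ) ^ (s + 2 * d)) := by
  have hp : p.Prime := Fact.out
  have hF' : Fintype.card F = p ^ (2 * s) := by rw [hF, hs]
  have hs0 : 0 < s := by rw [hs]; positivity
  have hq : ∀ a b : F, ∀ v : ZMod p, v ≠ 0 → ∃ t : F, t ≠ 0 ∧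
      ∀ x, traceQuad p s l a b (t * x) = v * traceQuad p s l a b x := by
    subst hs hlj
    exact fun a b v hv => exists_scaling hF a b hv
  have hA : #{a : F | a ^ p ^ s = a} = p ^ s := by
    refine card_pow_eq_self (Nat.one_lt_pow hs0.ne' hp.one_lt) ?_
    rw [hF', mul_comm, pow_mul]
    exact Nat.sub_one_dvd_pow_sub_one _ _
  have h1 := sum_levelDiff_traceQuad hq {a : F | a ^ p ^ s = a}
  have h2 := sum_levelDiff_traceQuad_sq hF' hodd hq
  have hpairs : #{z : F × F | z.1 ^ (p ^ s + 1) = z.2 ^ (p ^ s + 1)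
      ∧ z.1 ^ (p ^ l + 1) = z.2 ^ (p ^ l + 1)} = 1 + (p ^ d + 1) * (Fintype.card F - 1) := by
    subst hs hlj
    exact card_pairs hF hc
  rw [hpairs, hA, hF'] at h2
  rw [hA, hF'] at h1
  push_cast [Nat.one_le_pow (2 * s) p hp.pos] at h1 h2
  have h0 : ∑ a : F with a ^ p ^ s = a, ∑ b : F, (1 : ℤ) = (p : ℤ) ^ s * (p : ℤ) ^ (2 * s) := by
    simp [hA, hF']
  have hz : ∑ a : F with a ^ p ^ s = a, ∑ b : F, (if a = 0 ∧ b = 0 then (1 : ℤ) else 0) = 1 := by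
    have h : ∀ a : F, ∑ b : F, (if a = 0 ∧ b = 0 then (1 : ℤ) else 0)
        = if a = 0 then 1 else 0 := by
      intro a
      by_cases ha : a = 0 <;> simp [ha]
    simp [h, hp.ne_zero]
  have hpt : ∀ a ∈ ({a : F | a ^ p ^ s = a} : Finset F), ∀ b : F,
      levelDiff (traceQuad p s l a b) ^ 2
        + (p : ℤ) ^ s * (1 + ((p : ℤ) ^ d) ^ 2) * levelDiff (traceQuad p s l a b)
        + ((p : ℤ) ^ s) ^ 2 * ((p : ℤ) ^ d) ^ 2 * 1
      = (if levelDiff (traceQuad p s l a b) = (p : ℤ) ^ (s + d) then 1 else 0)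
            * (((p : ℤ) ^ s) ^ 2 * (p : ℤ) ^ d * ((p : ℤ) ^ d + 1) ^ 2)
        + (if a = 0 ∧ b = 0 then 1 else 0) *
          (((p : ℤ) ^ (2 * s) + (p : ℤ) ^ s) * ((p : ℤ) ^ (2 * s) + (p : ℤ) ^ (s + 2 * d))) := by
    intro a ha b
    have hP : (0 : ℤ) < (p : ℤ) ^ s := by have := hp.pos; positivity
    have hQ : (0 : ℤ) < (p : ℤ) ^ d := by have := hp.pos; positivity
    by_cases hab : a = 0 ∧ b = 0
    · rw [if_pos hab, hab.1, hab.2, levelDiff_traceQuad_zero, hF', if_neg]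
      · push_cast
        ring
      · have hds : d < s := by rw [hs]; nlinarith
        intro h
        have := Nat.pow_right_injective hp.two_le (by exact_mod_cast h : p ^ (2 * s) = p ^ (s + d))
        omega
    · rw [if_neg hab]
      rcases levelDiff_traceQuad hF hodd hd hg hl hs hlj (mem_filter.1 ha).2
        (by tauto : a ≠ 0 ∨ b ≠ 0) with h | h | h
      · rw [h, if_neg]
        · ring
        · have : (0 : ℤ) < (p : ℤ) ^ (s + d) := by rw [pow_add]; positivity
          linarith
      · rw [h, if_pos rfl]
        ring
      · rw [h, if_neg]
        · ring
        · have : (0 : ℤ) < (p : ℤ) ^ (s + d) := by rw [pow_add]; positivity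
          have : (0 : ℤ) < (p : ℤ) ^ (s + 2 * d) := by rw [pow_add, pow_mul']; positivity
          linarith
  have hsum := sum_congr (rfl : ({a : F | a ^ p ^ s = a} : Finset F) = _)
    fun a ha => sum_congr (rfl : (univ : Finset F) = _) fun b _ => hpt a ha b
  simp only [sum_add_distrib, ← mul_sum, ← sum_mul] at hsum
  rw [h0, h1, h2, hz, one_mul] at hsum
  linear_combination hsum

end Codewords

end

theorem stmt11 (p s l : ℕ) [Fact p.Prime] (F : Type) [Field F] [Fintype F] [DecidableEq F]
    [CharP F p] (hodd : Odd p) (hs : 2 ≤ s) (hl1 : 1 ≤ l) (hls : l ≠ s)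
    (hl2 : l ≤ 2 * s - 1) (hF : Fintype.card F = p ^ (2 * s)) (d : ℕ)
    (hd : Nat.gcd s l = d) (hd' : Nat.gcd (s + l) (2 * l) = 2 * d) :
    (((Finset.univ : Finset (F × F × F × ZMod p)).filter fun t =>
        t.1 ^ p ^ s = t.1 ∧ (suppw p s l t.1 t.2.1 t.2.2.1 t.2.2.2).card
          = p ^ (s + d - 1) * (p - 1) * (p ^ (s - d) - 1)).card : ℚ)
      = (p : ℚ) ^ (2 * s - d) * ((p : ℚ) ^ s + (p : ℚ) ^ (s - d) + (p : ℚ) ^ (s - 2 * d) + 1)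
          * ((p : ℚ) ^ (2 * s) - 1) / ((p : ℚ) ^ d + 1) ^ 2 := by
  let _ := ZMod.algebra F p
  have hp : p.Prime := Fact.out
  obtain ⟨hd0, i, j, hsi, hlj⟩ := exists_odd_mul_of_gcd (by omega) hd hd'
  have hF' := hF
  have hl : l ≤ 2 * s := by omega
  have hi : 0 < i := by
    rcases Nat.eq_zero_or_pos i with rfl | hi
    · have hsd : s = d := by omega
      have hj : j ≠ 0 := by
        rintro rfl
        omega
      have : d * (2 * j + 1) ≥ d * 3 := Nat.mul_le_mul_left _ (by omega)
      omega
    · exact hi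
  have hds : 3 * d ≤ s := by rw [hsi]; nlinarith
  have hg := hd'
  have hc := hd
  have hl' := hl
  rw [hsi, hlj] at hg hc hl'
  rw [hsi] at hF'
  have hx := card_levelDiff_eq hF' hodd hd0 hi hc hg hl' hsi hlj
  set N := ∑ a : F with a ^ p ^ s = a, ∑ b : F,
    if levelDiff (traceQuad p s l a b) = (p : ℤ) ^ (s + d) then (1 : ℤ) else 0
  refine count_eq (x := (N : ℚ)) hp.pos (by omega) (by exact_mod_cast hx) ?_
  rw [card_eq_sum_shifts s (fun a b c h => (suppw p s l a b c h).card
    = p ^ (s + d - 1) * (p - 1) * (p ^ (s - d) - 1))]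
  have : ((∑ a : F with a ^ p ^ s = a, ∑ b, (Finset.univ.filter fun u : F × ZMod p =>
      (suppw p s l a b u.1 u.2).card = p ^ (s + d - 1) * (p - 1) * (p ^ (s - d) - 1)).card : ℕ)
      : ℤ) * (p : ℤ) ^ (2 * d) = N * (p : ℤ) ^ (2 * s) := by
    push_cast
    simp only [N, Finset.sum_mul]
    refine Finset.sum_congr rfl fun a ha => Finset.sum_congr rfl fun b _ => ?_
    have h := card_shifts_traceQuad hF' hodd hd0 hi hg hl' hsi hlj
      (Finset.mem_filter.1 ha).2 b
    rw [ite_mul, one_mul, zero_mul]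
    exact_mod_cast h
  exact_mod_cast this
end
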